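/- arXiv:2507.17167 — 3 statements merged into one kernel-verified Lean document; each statement's English description precedes it below -/
import Mathlib

section
/- For every positive integer ℓ and every real s > 1 there exist constants c₁, c₂ > 0 (depending only on ℓ and s) such that for every sufficiently large real M one has c₁ · (log log M)^{ℓ−1} / (M^{s−1} · log M) ≤ P_ℓ(s; M) ≤ c₂ · (log log M)^{ℓ−1} / (M^{s−1} · log M). -/
open Filter

section PrimeSums

open Finset Chebyshev

/-- The primes in the half-open interval `(x, 4x]`. -/
noncomputable def windowPrimes (x : ℝ) : Finset ℕ := {p ∈ Finset.Ioc ⌊x⌋₊ ⌊4 * x⌋₊ | p.Prime}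

lemma mem_windowPrimes {x : ℝ} (hx : 0 ≤ x) {p : ℕ} :
    p ∈ windowPrimes x ↔ x < p ∧ (p : ℝ) ≤ 4 * x ∧ p.Prime := by
  simp [windowPrimes, Nat.floor_lt hx, Nat.le_floor_iff (show 0 ≤ 4 * x by positivity), and_assoc]

lemma sum_primesLE_four_mul {x : ℝ} (hx : 0 ≤ x) (f : ℕ → ℝ) :
    ∑ p ∈ Nat.primesLE ⌊4 * x⌋₊, f p =
      ∑ p ∈ Nat.primesLE ⌊x⌋₊, f p + ∑ p ∈ windowPrimes x, f p := by
  have hle : ⌊x⌋₊ ≤ ⌊4 * x⌋₊ := Nat.floor_mono (by linarith)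
  rw [← sum_union]
  · congr 1
    ext p
    simp only [Nat.mem_primesLE, windowPrimes, mem_union, mem_filter, mem_Ioc]
    constructor
    · rintro ⟨h1, h2⟩
      rcases le_or_gt p ⌊x⌋₊ with h | h
      · exact .inl ⟨h, h2⟩
      · exact .inr ⟨⟨h, h1⟩, h2⟩
    · rintro (⟨h1, h2⟩ | ⟨⟨h1, h2⟩, h3⟩)
      · exact ⟨h1.trans hle, h2⟩
      · exact ⟨h2, h3⟩
  · rw [disjoint_left]
    intro p hp hq
    simp only [Nat.mem_primesLE, windowPrimes, mem_filter, mem_Ioc] at hp hq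
    omega

lemma eventually_half_le_theta : ∀ᶠ x : ℝ in atTop, x / 2 ≤ θ x := by
  have h1 := (Real.isLittleO_log_id_atTop.bound (show (0 : ℝ) < 1 / 100 by norm_num))
  have h2 := (isLittleO_log_rpow_atTop (show (0 : ℝ) < 1 / 2 by norm_num)).bound
    (show (0 : ℝ) < 1 / 100 by norm_num)
  filter_upwards [h1, h2, eventually_ge_atTop (200 : ℝ)] with x h1 h2 hx
  have h3 := theta_ge' (x := x) (by linarith)
  have hlog : 0 ≤ Real.log x := Real.log_nonneg (by linarith)
  rw [Real.norm_of_nonneg hlog, Real.norm_of_nonneg (by simp; linarith)] at h1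
  rw [← Real.sqrt_eq_rpow, Real.norm_of_nonneg hlog, Real.norm_of_nonneg (Real.sqrt_nonneg x)] at h2
  simp only [id] at h1
  have h4 : Real.log (x + 2) ≤ 2 * Real.log x := by
    rw [← Real.log_rpow (by linarith)]
    apply Real.log_le_log (by linarith)
    norm_num
    nlinarith
  have h5 := Real.mul_self_sqrt (show 0 ≤ x by linarith)
  have h6 := Real.sqrt_nonneg x
  have := Real.log_two_gt_d9
  nlinarith

lemma eventually_card_windowPrimes_ge :
    ∀ᶠ x : ℝ in atTop, x / (2 * Real.log (4 * x)) ≤ #(windowPrimes x) := by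
  have h4 : Tendsto (fun x : ℝ => 4 * x) atTop atTop := tendsto_id.const_mul_atTop (by norm_num)
  filter_upwards [h4.eventually eventually_half_le_theta, eventually_ge_atTop (1 : ℝ)] with x h hx
  have hlog : 0 < Real.log (4 * x) := Real.log_pos (by linarith)
  have h1 := sum_primesLE_four_mul (show 0 ≤ x by linarith) (fun p => Real.log p)
  rw [← theta_eq_sum_primesLE, ← theta_eq_sum_primesLE] at h1
  have h2 : ∑ p ∈ windowPrimes x, Real.log p ≤ #(windowPrimes x) * Real.log (4 * x) := by
    rw [← nsmul_eq_mul]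
    refine sum_le_card_nsmul _ _ _ fun p hp => ?_
    rw [mem_windowPrimes (by linarith)] at hp
    exact Real.log_le_log (by linarith) hp.2.1
  have h3 := theta_le_log4_mul_x (show 0 ≤ x by linarith)
  have h5 : Real.log 4 = 2 * Real.log 2 := by
    rw [show (4 : ℝ) = 2 ^ 2 by norm_num, Real.log_pow]; norm_num
  have := Real.log_two_lt_d9
  rw [div_le_iff₀ (by positivity)]
  nlinarith

/-- The sum of the reciprocals of the primes up to `x`. -/
noncomputable def primeRecipSum (x : ℝ) : ℝ := ∑ p ∈ Nat.primesLE ⌊x⌋₊, (p : ℝ)⁻¹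

lemma primeRecipSum_mono : Monotone primeRecipSum := by
  intro x y hxy
  refine sum_le_sum_of_subset_of_nonneg (fun p => ?_) fun _ _ _ => by positivity
  simp only [Nat.mem_primesLE]
  exact fun h => ⟨h.1.trans (Nat.floor_mono hxy), h.2⟩

lemma primeRecipSum_nonneg (x : ℝ) : 0 ≤ primeRecipSum x := sum_nonneg fun _ _ => by positivity

lemma primeRecipSum_four_mul_le {x : ℝ} (hx : 1 < x) :
    primeRecipSum (4 * x) ≤ primeRecipSum x + 4 * Real.log 4 / Real.log x := by
  have hlog : 0 < Real.log x := Real.log_pos hx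
  rw [primeRecipSum, sum_primesLE_four_mul (by linarith)]
  refine add_le_add le_rfl ?_
  have h1 := sum_primesLE_four_mul (show 0 ≤ x by linarith) (fun p => Real.log p)
  rw [← theta_eq_sum_primesLE, ← theta_eq_sum_primesLE] at h1
  have h2 := theta_le_log4_mul_x (show 0 ≤ 4 * x by linarith)
  calc ∑ p ∈ windowPrimes x, (p : ℝ)⁻¹
      ≤ ∑ p ∈ windowPrimes x, (x * Real.log x)⁻¹ * Real.log p := by
        refine sum_le_sum fun p hp => ?_
        rw [mem_windowPrimes (by linarith)] at hp
        have hp0 : 0 < (p : ℝ) := by linarith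
        have : Real.log x ≤ Real.log p := Real.log_le_log (by linarith) hp.1.le
        rw [inv_mul_eq_div, le_div_iff₀ (by positivity), inv_mul_le_iff₀ hp0]
        exact mul_le_mul hp.1.le this hlog.le hp0.le
    _ ≤ (x * Real.log x)⁻¹ * (Real.log 4 * (4 * x)) := by
        rw [← mul_sum]
        gcongr
        linarith [theta_nonneg x]
    _ = _ := by field_simp

lemma eventually_primeRecipSum_four_mul_ge : ∀ᶠ x : ℝ in atTop,
    primeRecipSum x + 1 / (8 * Real.log (4 * x)) ≤ primeRecipSum (4 * x) := by
  filter_upwards [eventually_card_windowPrimes_ge, eventually_ge_atTop (1 : ℝ)] with x h hx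
  have hlog : 0 < Real.log (4 * x) := Real.log_pos (by linarith)
  rw [primeRecipSum, primeRecipSum, sum_primesLE_four_mul (by linarith)]
  refine add_le_add le_rfl ?_
  calc 1 / (8 * Real.log (4 * x)) = x / (2 * Real.log (4 * x)) * (4 * x)⁻¹ := by
        field_simp; norm_num
    _ ≤ #(windowPrimes x) * (4 * x)⁻¹ := by gcongr
    _ ≤ _ := by
        rw [← nsmul_eq_mul]
        refine card_nsmul_le_sum _ _ _ fun p hp => ?_
        rw [mem_windowPrimes (by linarith)] at hp
        exact inv_anti₀ (by linarith) hp.2.1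

lemma tendsto_log_log_atTop : Tendsto (fun x : ℝ => Real.log (Real.log x)) atTop atTop :=
  Real.tendsto_log_atTop.comp Real.tendsto_log_atTop

lemma exists_four_pow_near {x : ℝ} (hx : 4 ≤ x) :
    ∃ n : ℕ, 1 ≤ n ∧ (4 : ℝ) ^ n ≤ x ∧ x < 4 ^ (n + 1) ∧
      (n : ℝ) ≤ Real.log x ∧ Real.log x ≤ 2 * (n + 1 : ℕ) := by
  obtain ⟨n, h1, h2⟩ := exists_nat_pow_near (show 1 ≤ x by linarith) (show (1 : ℝ) < 4 by norm_num)
  have h4 : Real.log 4 = 2 * Real.log 2 := by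
    rw [show (4 : ℝ) = 2 ^ 2 by norm_num, Real.log_pow]; norm_num
  have l2 := Real.log_two_lt_d9
  have l1 := Real.log_two_gt_d9
  have h5 := Real.log_le_log (by positivity) h1
  have h6 := Real.log_le_log (by linarith) h2.le
  rw [Real.log_pow] at h5 h6
  refine ⟨n, ?_, h1, h2, ?_, ?_⟩
  · by_contra! h
    obtain rfl : n = 0 := by omega
    norm_num at h2
    linarith
  · nlinarith [(n.cast_nonneg : (0 : ℝ) ≤ n)]
  · nlinarith [((n + 1).cast_nonneg : (0 : ℝ) ≤ (n + 1 : ℕ))]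

/-- Mertens-type upper bound for the reciprocals of the primes. -/
lemma exists_primeRecipSum_le :
    ∃ C : ℝ, 0 < C ∧ ∀ᶠ x : ℝ in atTop, primeRecipSum x ≤ C * Real.log (Real.log x) := by
  have key : ∀ n : ℕ, primeRecipSum (4 ^ (n + 1)) ≤ primeRecipSum 4 + 4 * harmonic n := by
    intro n
    induction n with
    | zero => simp
    | succ n ih =>
      have h := primeRecipSum_four_mul_le (x := 4 ^ (n + 1)) (one_lt_pow₀ (by norm_num) (by omega))
      rw [← pow_succ', Real.log_pow] at h
      rw [harmonic_succ]
      have h4 : 0 < Real.log 4 := Real.log_pos (by norm_num)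
      have : 4 * Real.log 4 / (((n + 1 : ℕ) : ℝ) * Real.log 4) = 4 * ((n + 1 : ℕ) : ℝ)⁻¹ := by
        field_simp
      rw [this] at h
      push_cast at h ih ⊢
      linarith
  refine ⟨5, by norm_num, ?_⟩
  filter_upwards [tendsto_log_log_atTop.eventually_ge_atTop (primeRecipSum 4 + 4),
    eventually_ge_atTop (4 : ℝ)] with x h hx
  obtain ⟨n, hn, h1, h2, h3, h4⟩ := exists_four_pow_near hx
  have h5 := harmonic_le_one_add_log n
  have h6 : Real.log n ≤ Real.log (Real.log x) := Real.log_le_log (by positivity) h3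
  linarith [key n, primeRecipSum_mono h2.le]

/-- Mertens-type lower bound for the reciprocals of the primes. -/
lemma exists_le_primeRecipSum :
    ∃ c : ℝ, 0 < c ∧ ∀ᶠ x : ℝ in atTop, c * Real.log (Real.log x) ≤ primeRecipSum x := by
  obtain ⟨x₀, hx₀⟩ := eventually_atTop.1 eventually_primeRecipSum_four_mul_ge
  obtain ⟨m, hm⟩ := pow_unbounded_of_one_lt x₀ (show (1 : ℝ) < 4 by norm_num)
  have l4 : 0 < Real.log 4 := Real.log_pos (by norm_num)
  set c : ℝ := 1 / (8 * Real.log 4) with hc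
  have c0 : 0 < c := by positivity
  have key : ∀ n : ℕ, c * (harmonic n - harmonic m) ≤ primeRecipSum (4 ^ n) := by
    intro n
    induction n with
    | zero =>
      refine le_trans ?_ (primeRecipSum_nonneg _)
      have : (0 : ℝ) ≤ harmonic m := by
        exact_mod_cast (sum_nonneg fun _ _ => by positivity : (0 : ℚ) ≤ harmonic m)
      simp only [harmonic_zero, Rat.cast_zero]
      nlinarith
    | succ n ih =>
      rcases lt_or_ge n m with h | h
      · refine le_trans ?_ (primeRecipSum_nonneg _)
        have : (harmonic (n + 1) : ℝ) ≤ harmonic m := by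
          exact_mod_cast (sum_le_sum_of_subset_of_nonneg (range_mono h)
            fun _ _ _ => by positivity : harmonic (n + 1) ≤ harmonic m)
        nlinarith
      · have h1 := hx₀ (4 ^ n) (hm.le.trans (pow_le_pow_right₀ (by norm_num) h))
        rw [← pow_succ', Real.log_pow] at h1
        have : 1 / (8 * (((n + 1 : ℕ) : ℝ) * Real.log 4)) = c * ((n + 1 : ℕ) : ℝ)⁻¹ := by
          rw [hc]; field_simp
        rw [this] at h1
        rw [harmonic_succ]
        push_cast at h1 ih ⊢
        linarith
  refine ⟨c / 2, by positivity, ?_⟩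
  filter_upwards [tendsto_log_log_atTop.eventually_ge_atTop (2 * (Real.log 2 + harmonic m)),
    eventually_ge_atTop (4 : ℝ)] with x h hx
  obtain ⟨n, hn, h1, h2, h3, h4⟩ := exists_four_pow_near hx
  have h5 := log_add_one_le_harmonic n
  have h6 : Real.log (Real.log x) ≤ Real.log (2 * (n + 1 : ℕ)) :=
    Real.log_le_log (Real.log_pos (by linarith)) h4
  rw [Real.log_mul (by norm_num) (by positivity)] at h6
  refine le_trans ?_ ((key n).trans (primeRecipSum_mono h1))
  rw [div_mul_eq_mul_div, mul_div_assoc]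
  gcongr
  linarith

end PrimeSums

section AlmostPrimeCounts

open Finset
open scoped ArithmeticFunction.Omega

/-- The positive integers in `[a, b]` with at most `ℓ` prime factors counted with multiplicity. -/
noncomputable def almostPrimesIcc (ℓ : ℕ) (a b : ℝ) : Finset ℕ :=
  {k ∈ Finset.Icc ⌈a⌉₊ ⌊b⌋₊ | k ≠ 0 ∧ Ω k ≤ ℓ}

lemma mem_almostPrimesIcc {ℓ k : ℕ} {a b : ℝ} (hb : 0 ≤ b) :
    k ∈ almostPrimesIcc ℓ a b ↔ a ≤ k ∧ (k : ℝ) ≤ b ∧ k ≠ 0 ∧ Ω k ≤ ℓ := by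
  simp [almostPrimesIcc, Nat.le_floor_iff hb, and_assoc]

lemma card_almostPrimesIcc_succ_le (ℓ : ℕ) {x : ℝ} (hx : 0 ≤ x) :
    #(almostPrimesIcc (ℓ + 1) 0 x) ≤ #(almostPrimesIcc 1 0 x) +
      ∑ p ∈ Nat.primesLE ⌊√x⌋₊, #(almostPrimesIcc ℓ 0 (x / p)) := by
  have hsub : almostPrimesIcc (ℓ + 1) 0 x ⊆ almostPrimesIcc 1 0 x ∪
      (Nat.primesLE ⌊√x⌋₊).biUnion fun p => (almostPrimesIcc ℓ 0 (x / p)).image (p * ·) := by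
    intro k hk
    rw [mem_almostPrimesIcc hx] at hk
    obtain ⟨h0, hkx, hk0, hΩ⟩ := hk
    rw [mem_union]
    by_cases h1 : Ω k ≤ 1
    · exact .inl ((mem_almostPrimesIcc hx).2 ⟨h0, hkx, hk0, h1⟩)
    right
    have hk1 : k ≠ 1 := by rintro rfl; simp at h1
    have hkp : ¬ k.Prime := fun h => h1 (by simp [h])
    have hp := Nat.minFac_prime hk1
    obtain ⟨m, hm⟩ := k.minFac_dvd
    have hm0 : m ≠ 0 := by rintro rfl; simp at hm; exact hk0 hm
    have hΩm : Ω k = 1 + Ω m := by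
      conv_lhs => rw [hm]
      rw [ArithmeticFunction.cardFactors_mul hp.ne_zero hm0,
        ArithmeticFunction.cardFactors_apply_prime hp]
    simp only [mem_biUnion, mem_image, Nat.mem_primesLE]
    have hp0 : (0 : ℝ) < k.minFac := by exact_mod_cast hp.pos
    refine ⟨k.minFac, ⟨?_, hp⟩, m, ?_, hm.symm⟩
    · rw [Nat.le_floor_iff (Real.sqrt_nonneg x)]
      refine Real.le_sqrt_of_sq_le (le_trans ?_ hkx)
      exact_mod_cast Nat.minFac_sq_le_self (Nat.pos_of_ne_zero hk0) hkp
    · rw [mem_almostPrimesIcc (by positivity)]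
      refine ⟨by positivity, ?_, hm0, by omega⟩
      rw [le_div_iff₀ hp0]
      refine le_trans (le_of_eq ?_) hkx
      conv_rhs => rw [hm]
      push_cast
      ring
  refine (card_le_card hsub).trans ((card_union_le _ _).trans ?_)
  gcongr
  exact card_biUnion_le.trans (sum_le_sum fun p _ => card_image_le)

lemma sum_card_almostPrimesIcc_div_le (ℓ : ℕ) {P : Finset ℕ} (hP : ∀ p ∈ P, p.Prime) {x : ℝ}
    (hx : 0 ≤ x) :
    ∑ p ∈ P, #(almostPrimesIcc ℓ (x / p) (4 * (x / p))) ≤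
      #(almostPrimesIcc (ℓ + 1) x (4 * x)) * (ℓ + 1) := by
  set T := almostPrimesIcc (ℓ + 1) x (4 * x) with hT
  calc ∑ p ∈ P, #(almostPrimesIcc ℓ (x / p) (4 * (x / p)))
      ≤ ∑ p ∈ P, #(T.bipartiteAbove (fun p n => p ∣ n) p) := by
        refine sum_le_sum fun p hp => ?_
        have hpp := hP p hp
        have hp0 : (0 : ℝ) < p := by exact_mod_cast hpp.pos
        refine card_le_card_of_injOn (p * ·) (fun m hm => ?_) fun a _ b _ h =>
          Nat.eq_of_mul_eq_mul_left hpp.pos h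
        rw [mem_coe, mem_almostPrimesIcc (by positivity)] at hm
        obtain ⟨h1, h2, h3, h4⟩ := hm
        rw [mem_coe, mem_bipartiteAbove, hT, mem_almostPrimesIcc (by positivity)]
        refine ⟨⟨?_, ?_, mul_ne_zero hpp.ne_zero h3, ?_⟩, dvd_mul_right _ _⟩
        · rw [div_le_iff₀ hp0] at h1
          push_cast
          linarith
        · rw [← mul_div_assoc, le_div_iff₀ hp0] at h2
          push_cast
          linarith
        · rw [ArithmeticFunction.cardFactors_mul hpp.ne_zero h3,
            ArithmeticFunction.cardFactors_apply_prime hpp]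
          omega
    _ = ∑ n ∈ T, #(P.bipartiteBelow (fun p n => p ∣ n) n) :=
        sum_card_bipartiteAbove_eq_sum_card_bipartiteBelow _
    _ ≤ _ := by
        refine sum_le_card_nsmul _ _ _ fun n hn => ?_
        rw [hT, mem_almostPrimesIcc (by positivity)] at hn
        calc #(P.bipartiteBelow (fun p n => p ∣ n) n) ≤ #n.primeFactors := by
              refine card_le_card fun p hp => ?_
              rw [mem_bipartiteBelow] at hp
              exact Nat.mem_primeFactors.2 ⟨hP p hp.1, hp.2, hn.2.2.1⟩
          _ ≤ Ω n := List.toFinset_card_le _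
          _ ≤ ℓ + 1 := hn.2.2.2

lemma log_div_ge_half {x p : ℝ} (hx : 0 < x) (hp : 0 < p) (h : p ≤ √x) :
    √x ≤ x / p ∧ Real.log x / 2 ≤ Real.log (x / p) := by
  have h1 : √x ≤ x / p := by
    rw [le_div_iff₀ hp]
    calc √x * p ≤ √x * √x := by gcongr
      _ = x := Real.mul_self_sqrt hx.le
  refine ⟨h1, ?_⟩
  rw [← Real.log_sqrt hx.le]
  exact Real.log_le_log (Real.sqrt_pos.2 hx) h1

lemma exists_card_almostPrimesIcc_one_le : ∃ C : ℝ, 0 < C ∧ ∀ᶠ x : ℝ in atTop,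
    (#(almostPrimesIcc 1 0 x) : ℝ) ≤ C * x / Real.log x := by
  refine ⟨Real.log 4 + 2, by positivity, ?_⟩
  filter_upwards [Chebyshev.eventually_primeCounting_le one_pos, eventually_gt_atTop (1 : ℝ)]
    with x h hx
  have hlog := Real.log_pos hx
  have hsub : almostPrimesIcc 1 0 x ⊆ insert 1 (Nat.primesLE ⌊x⌋₊) := by
    intro k hk
    rw [mem_almostPrimesIcc (by linarith)] at hk
    obtain ⟨-, hkx, hk0, hΩ⟩ := hk
    rw [mem_insert, Nat.mem_primesLE, Nat.le_floor_iff (by linarith)]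
    rcases Nat.le_one_iff_eq_zero_or_eq_one.1 hΩ with h | h
    · simp at h; tauto
    · exact .inr ⟨hkx, ArithmeticFunction.cardFactors_eq_one_iff_prime.1 h⟩
  have h2 := (card_le_card hsub).trans (card_insert_le _ _)
  rw [Nat.primesLE_card_eq_primeCounting] at h2
  have h3 : 1 ≤ x / Real.log x := by
    rw [one_le_div hlog]
    linarith [Real.log_le_sub_one_of_pos (show 0 < x by linarith)]
  calc (#(almostPrimesIcc 1 0 x) : ℝ) ≤ Nat.primeCounting ⌊x⌋₊ + 1 := by exact_mod_cast h2
    _ ≤ (Real.log 4 + 1) * x / Real.log x + x / Real.log x := by gcongr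
    _ = _ := by ring

/-- Landau-type upper bound for the number of almost primes up to `x`. -/
lemma exists_card_almostPrimesIcc_le (k : ℕ) : ∃ C : ℝ, 0 < C ∧ ∀ᶠ x : ℝ in atTop,
    (#(almostPrimesIcc (k + 1) 0 x) : ℝ) ≤ C * x * Real.log (Real.log x) ^ k / Real.log x := by
  induction k with
  | zero => simpa using exists_card_almostPrimesIcc_one_le
  | succ k ih =>
    obtain ⟨C, C0, hC⟩ := ih
    obtain ⟨B, B0, hB⟩ := exists_card_almostPrimesIcc_one_le
    obtain ⟨D, D0, hD⟩ := exists_primeRecipSum_le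
    obtain ⟨x₀, hx₀⟩ := eventually_atTop.1 hC
    refine ⟨B + 2 * C * D, by positivity, ?_⟩
    filter_upwards [hB, hD, tendsto_log_log_atTop.eventually_ge_atTop 1,
      Real.tendsto_sqrt_atTop.eventually_ge_atTop x₀, eventually_ge_atTop (8 : ℝ),
      Real.tendsto_log_atTop.eventually_ge_atTop 2] with x hB hD hL hx hx8 hlog2
    have hlog : 0 < Real.log x := by linarith
    set L := Real.log (Real.log x) with hLdef
    have hterm : ∀ p ∈ Nat.primesLE ⌊√x⌋₊, (#(almostPrimesIcc (k + 1) 0 (x / p)) : ℝ) ≤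
        2 * C * x * L ^ k / Real.log x * (p : ℝ)⁻¹ := by
      intro p hp
      rw [Nat.mem_primesLE, Nat.le_floor_iff (Real.sqrt_nonneg x)] at hp
      have hp1 : (1 : ℝ) ≤ p := by exact_mod_cast hp.2.one_le
      have hp0 : (0 : ℝ) < p := by linarith
      obtain ⟨h1, h2⟩ := log_div_ge_half (show 0 < x by linarith) hp0 hp.1
      have h3 : Real.log (x / p) ≤ Real.log x :=
        Real.log_le_log (by positivity) (div_le_self (by linarith) hp1)
      have h4 : 0 ≤ Real.log (Real.log (x / p)) := Real.log_nonneg (by linarith)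
      have h5 : Real.log (Real.log (x / p)) ≤ L := Real.log_le_log (by linarith) h3
      calc (#(almostPrimesIcc (k + 1) 0 (x / p)) : ℝ)
          ≤ C * (x / p) * Real.log (Real.log (x / p)) ^ k / Real.log (x / p) :=
            hx₀ _ (hx.trans h1)
        _ ≤ C * (x / p) * L ^ k / (Real.log x / 2) := by gcongr
        _ = _ := by field_simp
    have hsqrt : √x ≤ x := by
      rw [Real.sqrt_le_left (by linarith)]
      nlinarith
    calc (#(almostPrimesIcc (k + 1 + 1) 0 x) : ℝ)
        ≤ #(almostPrimesIcc 1 0 x) +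
            ∑ p ∈ Nat.primesLE ⌊√x⌋₊, (#(almostPrimesIcc (k + 1) 0 (x / p)) : ℝ) := by
          exact_mod_cast card_almostPrimesIcc_succ_le (k + 1) (by linarith)
      _ ≤ B * x / Real.log x + 2 * C * x * L ^ k / Real.log x * primeRecipSum (√x) := by
          rw [primeRecipSum, mul_sum]
          exact add_le_add hB (sum_le_sum hterm)
      _ ≤ B * x * L ^ (k + 1) / Real.log x + 2 * C * x * L ^ k / Real.log x * (D * L) := by
          have h1 : B * x ≤ B * x * L ^ (k + 1) :=
            le_mul_of_one_le_right (by positivity) (one_le_pow₀ hL)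
          have h2 := (primeRecipSum_mono hsqrt).trans hD
          gcongr
      _ = _ := by ring

lemma exists_le_card_almostPrimesIcc_one : ∃ c : ℝ, 0 < c ∧ ∀ᶠ x : ℝ in atTop,
    c * x / Real.log x ≤ #(almostPrimesIcc 1 x (4 * x)) := by
  refine ⟨1 / 4, by norm_num, ?_⟩
  filter_upwards [eventually_card_windowPrimes_ge, eventually_ge_atTop (4 : ℝ)] with x h hx
  have hlog : 0 < Real.log x := Real.log_pos (by linarith)
  have hlog4 : Real.log 4 ≤ Real.log x := Real.log_le_log (by norm_num) hx
  have hsub : windowPrimes x ⊆ almostPrimesIcc 1 x (4 * x) := by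
    intro p hp
    rw [mem_windowPrimes (by linarith)] at hp
    rw [mem_almostPrimesIcc (by linarith)]
    exact ⟨hp.1.le, hp.2.1, hp.2.2.ne_zero, by simp [hp.2.2]⟩
  calc 1 / 4 * x / Real.log x = x / (2 * (Real.log x + Real.log x)) := by field_simp; norm_num
    _ ≤ x / (2 * Real.log (4 * x)) := by
        rw [Real.log_mul (by norm_num) (by linarith)]
        have := Real.log_pos (show (1 : ℝ) < 4 by norm_num)
        gcongr
    _ ≤ #(windowPrimes x) := h
    _ ≤ _ := by exact_mod_cast card_le_card hsub

/-- Landau-type lower bound for the number of almost primes in `[x, 4x]`. -/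
lemma exists_le_card_almostPrimesIcc (k : ℕ) : ∃ c : ℝ, 0 < c ∧ ∀ᶠ x : ℝ in atTop,
    c * x * Real.log (Real.log x) ^ k / Real.log x ≤ #(almostPrimesIcc (k + 1) x (4 * x)) := by
  induction k with
  | zero => simpa using exists_le_card_almostPrimesIcc_one
  | succ k ih =>
    obtain ⟨c, c0, hc⟩ := ih
    obtain ⟨d, d0, hd⟩ := exists_le_primeRecipSum
    obtain ⟨x₀, hx₀⟩ := eventually_atTop.1 hc
    refine ⟨c * d / (2 ^ (k + 1) * (k + 2)), by positivity, ?_⟩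
    filter_upwards [Real.tendsto_sqrt_atTop.eventually hd,
      tendsto_log_log_atTop.eventually_ge_atTop (2 * Real.log 2),
      Real.tendsto_sqrt_atTop.eventually_ge_atTop x₀, eventually_ge_atTop (8 : ℝ),
      Real.tendsto_log_atTop.eventually_ge_atTop 2] with x hd hL hx hx8 hlog2
    have hlog : 0 < Real.log x := by linarith
    set L := Real.log (Real.log x) with hLdef
    have hL0 : 0 ≤ L := le_trans (by positivity) hL
    have hhalf : L / 2 ≤ Real.log (Real.log x / 2) := by
      rw [Real.log_div (by linarith) (by norm_num), ← hLdef]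
      linarith
    have hterm : ∀ p ∈ Nat.primesLE ⌊√x⌋₊, c * x * (L / 2) ^ k / Real.log x * (p : ℝ)⁻¹ ≤
        #(almostPrimesIcc (k + 1) (x / p) (4 * (x / p))) := by
      intro p hp
      rw [Nat.mem_primesLE, Nat.le_floor_iff (Real.sqrt_nonneg x)] at hp
      have hp1 : (1 : ℝ) ≤ p := by exact_mod_cast hp.2.one_le
      have hp0 : (0 : ℝ) < p := by linarith
      obtain ⟨h1, h2⟩ := log_div_ge_half (show 0 < x by linarith) hp0 hp.1
      have h3 : Real.log (x / p) ≤ Real.log x :=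
        Real.log_le_log (by positivity) (div_le_self (by linarith) hp1)
      have h5 : L / 2 ≤ Real.log (Real.log (x / p)) :=
        hhalf.trans (Real.log_le_log (by linarith) h2)
      have h6 : 0 < Real.log (x / p) := by linarith
      have h7 : 0 ≤ Real.log (Real.log (x / p)) := by linarith
      calc c * x * (L / 2) ^ k / Real.log x * (p : ℝ)⁻¹
          = c * (x / p) * (L / 2) ^ k / Real.log x := by field_simp
        _ ≤ c * (x / p) * Real.log (Real.log (x / p)) ^ k / Real.log (x / p) := by gcongr
        _ ≤ _ := hx₀ _ (hx.trans h1)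
    have hcount : ∑ p ∈ Nat.primesLE ⌊√x⌋₊,
        (#(almostPrimesIcc (k + 1) (x / p) (4 * (x / p))) : ℝ) ≤
          #(almostPrimesIcc (k + 1 + 1) x (4 * x)) * (k + 2) := by
      have := sum_card_almostPrimesIcc_div_le (k + 1) (P := Nat.primesLE ⌊√x⌋₊)
        (fun p hp => Nat.prime_of_mem_primesLE hp) (show 0 ≤ x by linarith)
      exact_mod_cast this
    rw [Real.log_sqrt (by linarith)] at hd
    calc c * d / (2 ^ (k + 1) * (k + 2)) * x * L ^ (k + 1) / Real.log x
        = (c * x * (L / 2) ^ k / Real.log x * (d * (L / 2))) / (k + 2) := by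
          rw [div_pow]; field_simp; ring
      _ ≤ (c * x * (L / 2) ^ k / Real.log x * (d * Real.log (Real.log x / 2))) / (k + 2) := by
          gcongr
      _ ≤ (c * x * (L / 2) ^ k / Real.log x * primeRecipSum (√x)) / (k + 2) := by gcongr
      _ ≤ (#(almostPrimesIcc (k + 1 + 1) x (4 * x)) * (k + 2)) / (k + 2) := by
          refine div_le_div_of_nonneg_right ?_ (by positivity)
          rw [primeRecipSum, mul_sum]
          exact (sum_le_sum hterm).trans hcount
      _ = _ := by field_simp

end AlmostPrimeCounts

section Tail

open Finset
open scoped ArithmeticFunction.Omega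

lemma log_log_two_pow_mul_le {M : ℝ} (hM : 2 ≤ M) (hL : 1 ≤ Real.log (Real.log M)) (n : ℕ) :
    Real.log (Real.log (2 ^ n * M)) ≤ (n + 1) * Real.log (Real.log M) := by
  have h2 : Real.log 2 ≤ Real.log M := Real.log_le_log (by norm_num) hM
  have hlog : 0 < Real.log M := Real.log_pos (by linarith)
  have h1 : Real.log (2 ^ n * M) ≤ (n + 1) * Real.log M := by
    rw [Real.log_mul (by positivity) (by positivity), Real.log_pow]
    nlinarith [(n.cast_nonneg : (0 : ℝ) ≤ n)]
  have h3 : 0 < Real.log (2 ^ n * M) :=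
    Real.log_pos (by nlinarith [one_le_pow₀ (M₀ := ℝ) (n := n) one_le_two])
  have h4 := Real.log_le_log h3 h1
  rw [Real.log_mul (by positivity) hlog.ne'] at h4
  have h5 := Real.log_le_sub_one_of_pos (show (0 : ℝ) < n + 1 by positivity)
  nlinarith [(n.cast_nonneg : (0 : ℝ) ≤ n)]

lemma summable_tail_term (ℓ : ℕ) {s : ℝ} (hs : 1 < s) (M : ℝ) :
    Summable fun k : ℕ => if 1 ≤ k ∧ M ≤ (k : ℝ) ∧ k.primeFactorsList.length ≤ ℓ
      then 1 / (k : ℝ) ^ s else 0 := by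
  refine (Real.summable_one_div_nat_rpow.2 hs).of_nonneg_of_le (fun k => ?_) fun k => ?_
  · split_ifs <;> positivity
  · split_ifs
    · exact le_rfl
    · positivity

lemma sum_almostPrimesIcc_halves_le (ℓ : ℕ) {s X : ℝ} (hs : 0 ≤ s) (hX : 0 < X) :
    ∑ i ∈ almostPrimesIcc ℓ (X / 2) X, 1 / (i : ℝ) ^ s ≤
      #(almostPrimesIcc ℓ 0 X) * (2 ^ s * X ^ (-s)) := by
  have hsub : almostPrimesIcc ℓ (X / 2) X ⊆ almostPrimesIcc ℓ 0 X := by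
    intro i hi
    rw [mem_almostPrimesIcc hX.le] at hi ⊢
    exact ⟨by positivity, hi.2⟩
  calc ∑ i ∈ almostPrimesIcc ℓ (X / 2) X, 1 / (i : ℝ) ^ s
      ≤ #(almostPrimesIcc ℓ (X / 2) X) * (2 ^ s * X ^ (-s)) := by
        rw [← nsmul_eq_mul]
        refine sum_le_card_nsmul _ _ _ fun i hi => ?_
        rw [mem_almostPrimesIcc hX.le] at hi
        calc 1 / (i : ℝ) ^ s ≤ 1 / (X / 2) ^ s := by
              gcongr
              exact hi.1
          _ = 2 ^ s * X ^ (-s) := by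
              rw [Real.div_rpow hX.le (by norm_num), Real.rpow_neg hX.le]
              field_simp
    _ ≤ _ := by
        gcongr

lemma sum_almostPrimesIcc_dyadic_le {k : ℕ} {C x₀ s M : ℝ} (C0 : 0 < C) (hs : 1 < s)
    (hC : ∀ x ≥ x₀, (#(almostPrimesIcc (k + 1) 0 x) : ℝ) ≤
      C * x * Real.log (Real.log x) ^ k / Real.log x)
    (hM₀ : x₀ ≤ M) (hM : 2 ≤ M) (hL : 1 ≤ Real.log (Real.log M)) (n : ℕ) :
    ∑ i ∈ almostPrimesIcc (k + 1) M (2 ^ n * M / 2), 1 / (i : ℝ) ^ s ≤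
      (2 ^ s * C * M ^ (1 - s) * Real.log (Real.log M) ^ k / Real.log M) *
        ∑ j ∈ range n, ((j : ℝ) + 1) ^ k * (2 ^ (1 - s)) ^ j := by
  have hM0 : 0 < M := by linarith
  have hlog : 0 < Real.log M := Real.log_pos (by linarith)
  induction n with
  | zero =>
    rw [range_zero, sum_empty, mul_zero]
    refine (sum_eq_zero fun i hi => ?_).le
    rw [mem_almostPrimesIcc (by positivity)] at hi
    linarith [hi.1, hi.2.1]
  | succ n ih =>
    set X : ℝ := 2 ^ n * M with hX
    have hX0 : 0 < X := by positivity
    have hMX : M ≤ X := le_mul_of_one_le_left hM0.le (one_le_pow₀ one_le_two)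
    have hX2 : 2 ^ (n + 1) * M / 2 = X := by rw [hX]; ring
    have hlogX : Real.log M ≤ Real.log X := Real.log_le_log hM0 hMX
    have hsub : almostPrimesIcc (k + 1) M X ⊆
        almostPrimesIcc (k + 1) M (X / 2) ∪ almostPrimesIcc (k + 1) (X / 2) X := by
      intro i hi
      rw [mem_union]
      rw [mem_almostPrimesIcc hX0.le] at hi
      rcases le_total (i : ℝ) (X / 2) with h | h
      · exact .inl ((mem_almostPrimesIcc (by positivity)).2 ⟨hi.1, h, hi.2.2⟩)
      · exact .inr ((mem_almostPrimesIcc hX0.le).2 ⟨h, hi.2⟩)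
    have hpow : X * X ^ (-s) = (2 ^ (1 - s)) ^ n * M ^ (1 - s) := by
      rw [show X * X ^ (-s) = X ^ (1 - s) by
        rw [sub_eq_add_neg, Real.rpow_add hX0, Real.rpow_one], hX,
        Real.mul_rpow (by positivity) hM0.le, Real.rpow_pow_comm (by norm_num)]
    have hblock : ∑ i ∈ almostPrimesIcc (k + 1) (X / 2) X, 1 / (i : ℝ) ^ s ≤
        (2 ^ s * C * M ^ (1 - s) * Real.log (Real.log M) ^ k / Real.log M) *
          (((n : ℝ) + 1) ^ k * (2 ^ (1 - s)) ^ n) := by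
      have hLX : 0 ≤ Real.log (Real.log X) :=
        zero_le_one.trans (hL.trans (Real.log_le_log hlog hlogX))
      calc ∑ i ∈ almostPrimesIcc (k + 1) (X / 2) X, 1 / (i : ℝ) ^ s
          ≤ #(almostPrimesIcc (k + 1) 0 X) * (2 ^ s * X ^ (-s)) :=
            sum_almostPrimesIcc_halves_le _ (by linarith) hX0
        _ ≤ (C * X * Real.log (Real.log X) ^ k / Real.log X) * (2 ^ s * X ^ (-s)) := by
            gcongr
            exact hC X (hM₀.trans hMX)
        _ ≤ (C * X * ((n + 1) * Real.log (Real.log M)) ^ k / Real.log M) *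
              (2 ^ s * X ^ (-s)) := by
            gcongr
            exact log_log_two_pow_mul_le hM hL n
        _ = 2 ^ s * C * (X * X ^ (-s)) * ((n + 1) * Real.log (Real.log M)) ^ k / Real.log M := by
            ring
        _ = _ := by
            rw [hpow, mul_pow]
            ring
    rw [hX2, sum_range_succ, mul_add]
    calc ∑ i ∈ almostPrimesIcc (k + 1) M X, 1 / (i : ℝ) ^ s
        ≤ ∑ i ∈ almostPrimesIcc (k + 1) M (X / 2) ∪ almostPrimesIcc (k + 1) (X / 2) X,
            1 / (i : ℝ) ^ s :=
          sum_le_sum_of_subset_of_nonneg hsub fun _ _ _ => by positivity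
      _ ≤ ∑ i ∈ almostPrimesIcc (k + 1) M (X / 2), 1 / (i : ℝ) ^ s +
            ∑ i ∈ almostPrimesIcc (k + 1) (X / 2) X, 1 / (i : ℝ) ^ s := by
          rw [← sum_union_inter]
          exact le_add_of_nonneg_right (sum_nonneg fun _ _ => by positivity)
      _ ≤ _ := add_le_add ih hblock

lemma exists_tail_le (k : ℕ) {s : ℝ} (hs : 1 < s) : ∃ C : ℝ, 0 < C ∧ ∀ᶠ M : ℝ in atTop,
    (∑' i : ℕ, if 1 ≤ i ∧ M ≤ (i : ℝ) ∧ i.primeFactorsList.length ≤ k + 1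
      then 1 / (i : ℝ) ^ s else 0) ≤
      C * Real.log (Real.log M) ^ k / (M ^ (s - 1) * Real.log M) := by
  obtain ⟨C, C0, hC⟩ := exists_card_almostPrimesIcc_le k
  obtain ⟨x₀, hx₀⟩ := eventually_atTop.1 hC
  set r : ℕ → ℝ := fun j => ((j : ℝ) + 1) ^ k * (2 ^ (1 - s)) ^ j with hr
  have hq0 : (0 : ℝ) < 2 ^ (1 - s) := by positivity
  have hq1 : (2 : ℝ) ^ (1 - s) < 1 :=
    Real.rpow_lt_one_of_one_lt_of_neg (by norm_num) (by linarith)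
  have hsum : Summable r := by
    have h := summable_pow_mul_geometric_of_norm_lt_one k
      (r := (2 : ℝ) ^ (1 - s)) (by rwa [Real.norm_of_nonneg hq0.le])
    refine (((summable_nat_add_iff 1).2 h).mul_right ((2 : ℝ) ^ (1 - s))⁻¹).congr fun j => ?_
    simp only [hr]
    push_cast
    rw [pow_succ]
    field_simp
  have hr0 : ∀ j, 0 < r j := fun j => by positivity
  have hR : 0 < ∑' j, r j := hsum.tsum_pos (fun j => (hr0 j).le) 0 (hr0 0)
  refine ⟨2 ^ s * C * ∑' j, r j, by positivity, ?_⟩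
  filter_upwards [eventually_ge_atTop x₀, eventually_ge_atTop (2 : ℝ),
    tendsto_log_log_atTop.eventually_ge_atTop 1] with M hM₀ hM hL
  have hM0 : 0 < M := by linarith
  have hlog : 0 < Real.log M := Real.log_pos (by linarith)
  refine Real.tsum_le_of_sum_range_le (fun i => by split_ifs <;> positivity) fun n => ?_
  have hn : (n : ℝ) ≤ 2 ^ n * M / 2 := by
    have : (n : ℝ) ≤ 2 ^ n := by exact_mod_cast Nat.lt_two_pow_self.le
    nlinarith
  calc ∑ i ∈ range n, (if 1 ≤ i ∧ M ≤ (i : ℝ) ∧ i.primeFactorsList.length ≤ k + 1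
        then 1 / (i : ℝ) ^ s else 0)
      ≤ ∑ i ∈ almostPrimesIcc (k + 1) M (2 ^ n * M / 2), 1 / (i : ℝ) ^ s := by
        rw [← sum_filter]
        refine sum_le_sum_of_subset_of_nonneg (fun i hi => ?_) fun _ _ _ => by positivity
        rw [mem_filter, mem_range] at hi
        obtain ⟨hin, h1, h2, h3⟩ := hi
        rw [mem_almostPrimesIcc (by positivity)]
        exact ⟨h2, le_trans (by exact_mod_cast hin.le) hn, by omega, h3⟩
    _ ≤ (2 ^ s * C * M ^ (1 - s) * Real.log (Real.log M) ^ k / Real.log M) *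
          ∑ j ∈ range n, r j := sum_almostPrimesIcc_dyadic_le C0 hs hx₀ hM₀ hM hL n
    _ ≤ (2 ^ s * C * M ^ (1 - s) * Real.log (Real.log M) ^ k / Real.log M) * ∑' j, r j := by
        gcongr
        exact hsum.sum_le_tsum _ fun j _ => (hr0 j).le
    _ = _ := by
        rw [show 1 - s = -(s - 1) by ring, Real.rpow_neg hM0.le]
        field_simp

lemma exists_le_tail (k : ℕ) {s : ℝ} (hs : 1 < s) : ∃ c : ℝ, 0 < c ∧ ∀ᶠ M : ℝ in atTop,
    c * Real.log (Real.log M) ^ k / (M ^ (s - 1) * Real.log M) ≤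
      ∑' i : ℕ, if 1 ≤ i ∧ M ≤ (i : ℝ) ∧ i.primeFactorsList.length ≤ k + 1
        then 1 / (i : ℝ) ^ s else 0 := by
  obtain ⟨c, c0, hc⟩ := exists_le_card_almostPrimesIcc k
  refine ⟨c / 4 ^ s, by positivity, ?_⟩
  filter_upwards [hc, eventually_gt_atTop (1 : ℝ)] with M hc hM
  have hM0 : 0 < M := by linarith
  have hlog : 0 < Real.log M := Real.log_pos hM
  calc c / 4 ^ s * Real.log (Real.log M) ^ k / (M ^ (s - 1) * Real.log M)
      = c * M * Real.log (Real.log M) ^ k / Real.log M * (1 / (4 * M) ^ s) := by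
        rw [Real.mul_rpow (by norm_num) hM0.le, Real.rpow_sub_one hM0.ne']
        field_simp
    _ ≤ #(almostPrimesIcc (k + 1) M (4 * M)) * (1 / (4 * M) ^ s) := by gcongr
    _ ≤ ∑ i ∈ almostPrimesIcc (k + 1) M (4 * M),
          (if 1 ≤ i ∧ M ≤ (i : ℝ) ∧ i.primeFactorsList.length ≤ k + 1
            then 1 / (i : ℝ) ^ s else 0) := by
        rw [← nsmul_eq_mul]
        refine card_nsmul_le_sum _ _ _ fun i hi => ?_
        rw [mem_almostPrimesIcc (by positivity)] at hi
        obtain ⟨h1, h2, h3, h4⟩ := hi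
        have hi0 : (0 : ℝ) < i := by linarith
        rw [if_pos ⟨Nat.one_le_iff_ne_zero.2 h3, h1, h4⟩]
        gcongr
    _ ≤ _ := (summable_tail_term _ hs M).sum_le_tsum _ fun i _ => by split_ifs <;> positivity

end Tail

/-- **Theorem (tail of the almost prime zeta function).**
For every positive integer `ℓ` and every real `s > 1` there are constants `c₁, c₂ > 0`
(depending only on `ℓ` and `s`) such that for every sufficiently large real `M`,
`c₁ (log log M)^{ℓ-1} / (M^{s-1} log M) ≤ P_ℓ(s; M) ≤ c₂ (log log M)^{ℓ-1} / (M^{s-1} log M)`,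
where `P_ℓ(s; M) = ∑_{k ∈ Ω(ℓ), k ≥ M} 1/k^s` and `Ω(ℓ)` is the set of positive integers
with at most `ℓ` prime factors counted with multiplicity. -/
theorem almostPrimeZeta_tail_asymp (ℓ : ℕ) (hℓ : 1 ≤ ℓ) (s : ℝ) (hs : 1 < s) :
    ∃ c₁ c₂ : ℝ, 0 < c₁ ∧ 0 < c₂ ∧ ∀ᶠ M : ℝ in atTop,
      c₁ * (Real.log (Real.log M)) ^ (ℓ - 1) / (M ^ (s - 1) * Real.log M) ≤
        (∑' k : ℕ, if 1 ≤ k ∧ M ≤ (k : ℝ) ∧ k.primeFactorsList.length ≤ ℓ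
          then 1 / (k : ℝ) ^ s else 0) ∧
      (∑' k : ℕ, if 1 ≤ k ∧ M ≤ (k : ℝ) ∧ k.primeFactorsList.length ≤ ℓ
          then 1 / (k : ℝ) ^ s else 0) ≤
        c₂ * (Real.log (Real.log M)) ^ (ℓ - 1) / (M ^ (s - 1) * Real.log M) := by
  obtain ⟨k, rfl⟩ : ∃ k, ℓ = k + 1 := ⟨ℓ - 1, by omega⟩
  obtain ⟨c₁, h₁, hc₁⟩ := exists_le_tail k hs
  obtain ⟨c₂, h₂, hc₂⟩ := exists_tail_le k hs
  exact ⟨c₁, c₂, h₁, h₂, hc₁.and hc₂⟩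
end

section
/- For every real s > 1 there exist constants c₁, c₂ > 0 (depending only on s) such that for every sufficiently large real M one has c₁ / (M^{s−1} · log M) ≤ Σ_{p prime, p > M} 1/p^{s} ≤ c₂ / (M^{s−1} · log M). -/
open Filter

/-- A linear lower bound for the Chebyshev function `θ`. -/
lemma eventually_mul_log_two_le_theta :
    ∀ᶠ x : ℝ in atTop, x * Real.log 2 / 2 ≤ Chebyshev.theta x := by
  have hlog2 : 0 < Real.log 2 := Real.log_pos one_lt_two
  have hlog := (isLittleO_log_rpow_atTop (r := 1 / 2) (by norm_num)).bound
    (show 0 < Real.log 2 / 16 by positivity)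
  filter_upwards [hlog, eventually_ge_atTop 4] with x hx hx4
  have hx0 : 0 < x := by linarith
  have hlx : 0 ≤ Real.log x := Real.log_nonneg (by linarith)
  rw [← Real.sqrt_eq_rpow, Real.norm_of_nonneg hlx, Real.norm_of_nonneg (Real.sqrt_nonneg x)] at hx
  have hsq : √x * √x = x := Real.mul_self_sqrt hx0.le
  have hsqrt : 1 ≤ √x := Real.one_le_sqrt.2 (by linarith)
  have hadd : Real.log (x + 2) ≤ 2 * Real.log x := by
    rw [← Real.log_rpow hx0 2]
    apply Real.log_le_log (by linarith)
    rw [Real.rpow_two]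
    nlinarith
  have hprod : √x * Real.log x ≤ Real.log 2 / 16 * x := by
    calc √x * Real.log x ≤ √x * (Real.log 2 / 16 * √x) := by gcongr
      _ = Real.log 2 / 16 * (√x * √x) := by ring
      _ = Real.log 2 / 16 * x := by rw [hsq]
  have hle : Real.log x ≤ √x * Real.log x := le_mul_of_one_le_left hlx hsqrt
  have := Chebyshev.theta_ge' (x := x) (by linarith)
  nlinarith

/-- Primes in the dyadic interval `(M, 2M]`, weighted by `log p / p ^ s`. -/
lemma sum_prime_dyadic_log_div_rpow_le {s M : ℝ} (hs : 0 ≤ s) (hM : 0 < M) (N : ℕ) :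
    (∑ p ∈ Finset.range N, if p.Prime ∧ M < (p : ℝ) ∧ (p : ℝ) ≤ 2 * M then
      Real.log p / (p : ℝ) ^ s else 0) ≤ 2 * Real.log 4 * M ^ (1 - s) := by
  have hsub : (Finset.range N).filter
      (fun p : ℕ ↦ p.Prime ∧ M < (p : ℝ) ∧ (p : ℝ) ≤ 2 * M) ⊆
      (Finset.Ioc 0 ⌊2 * M⌋₊).filter Nat.Prime := by
    intro p hp
    simp only [Finset.mem_filter, Finset.mem_Ioc] at hp ⊢
    exact ⟨⟨hp.2.1.pos, Nat.le_floor hp.2.2.2⟩, hp.2.1⟩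
  rw [← Finset.sum_filter]
  calc _ ≤ ∑ p ∈ (Finset.range N).filter
        (fun p : ℕ ↦ p.Prime ∧ M < (p : ℝ) ∧ (p : ℝ) ≤ 2 * M), Real.log p / M ^ s := by
        refine Finset.sum_le_sum fun p hp ↦ ?_
        have hMp := (Finset.mem_filter.1 hp).2.2.1
        have := Real.log_natCast_nonneg p
        gcongr
    _ ≤ ∑ p ∈ (Finset.Ioc 0 ⌊2 * M⌋₊).filter Nat.Prime, Real.log p / M ^ s :=
        Finset.sum_le_sum_of_subset_of_nonneg hsub fun p _ _ ↦
          div_nonneg (Real.log_natCast_nonneg p) (by positivity)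
    _ = Chebyshev.theta (2 * M) / M ^ s := by rw [Chebyshev.theta, Finset.sum_div]
    _ ≤ Real.log 4 * (2 * M) / M ^ s := by
        gcongr
        exact Chebyshev.theta_le_log4_mul_x (by positivity)
    _ = 2 * Real.log 4 * M ^ (1 - s) := by
        rw [Real.rpow_sub hM, Real.rpow_one]
        ring

lemma sum_prime_log_div_rpow_le {s : ℝ} (hs : 1 < s) (N k : ℕ) {M : ℝ} (hM : 0 < M)
    (hN : (N : ℝ) ≤ 2 ^ k * M) :
    (∑ p ∈ Finset.range N, if p.Prime ∧ M < (p : ℝ) then Real.log p / (p : ℝ) ^ s else 0) ≤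
      2 * Real.log 4 / (1 - 2 ^ (1 - s)) * M ^ (1 - s) := by
  have hr : (2 : ℝ) ^ (1 - s) < 1 :=
    Real.rpow_lt_one_of_one_lt_of_neg one_lt_two (by linarith)
  have hr' : 0 < 1 - (2 : ℝ) ^ (1 - s) := by linarith
  have hlog4 : 0 < Real.log 4 := Real.log_pos (by norm_num)
  induction k generalizing M with
  | zero =>
    rw [Finset.sum_eq_zero]
    · positivity
    · intro p hp
      have : (p : ℝ) < N := by exact_mod_cast Finset.mem_range.1 hp
      rw [if_neg]
      rintro ⟨-, h⟩
      linarith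
  | succ k ih =>
    have ih := ih (M := 2 * M) (by positivity) (by rw [pow_succ] at hN; linarith)
    have hdyadic := sum_prime_dyadic_log_div_rpow_le (s := s) (by linarith) hM N
    have hsplit : ∀ p : ℕ, (if p.Prime ∧ M < (p : ℝ) then Real.log p / (p : ℝ) ^ s else 0) =
        (if p.Prime ∧ M < (p : ℝ) ∧ (p : ℝ) ≤ 2 * M then Real.log p / (p : ℝ) ^ s else 0) +
        (if p.Prime ∧ 2 * M < (p : ℝ) then Real.log p / (p : ℝ) ^ s else 0) := by
      intro p
      grind
    rw [Finset.sum_congr rfl fun p _ ↦ hsplit p, Finset.sum_add_distrib]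
    refine (add_le_add hdyadic ih).trans_eq ?_
    rw [Real.mul_rpow (by norm_num) hM.le]
    field_simp
    ring

lemma summable_prime_tail_rpow {s : ℝ} (hs : 1 < s) (M : ℝ) :
    Summable fun p : ℕ ↦ if p.Prime ∧ M < (p : ℝ) then 1 / (p : ℝ) ^ s else 0 := by
  refine Summable.of_nonneg_of_le (fun p ↦ ?_) (fun p ↦ ?_) (Real.summable_one_div_nat_rpow.2 hs)
  · split_ifs <;> positivity
  · split_ifs
    · exact le_rfl
    · positivity

lemma tsum_prime_tail_rpow_le {s M : ℝ} (hs : 1 < s) (hM : 1 < M) :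
    (∑' p : ℕ, if p.Prime ∧ M < (p : ℝ) then 1 / (p : ℝ) ^ s else 0) ≤
      2 * Real.log 4 / (1 - 2 ^ (1 - s)) / (M ^ (s - 1) * Real.log M) := by
  have hM0 : 0 < M := by linarith
  have hlog : 0 < Real.log M := Real.log_pos hM
  refine Real.tsum_le_of_sum_range_le (fun p ↦ by split_ifs <;> positivity) fun N ↦ ?_
  obtain ⟨k, hk⟩ := pow_unbounded_of_one_lt (N : ℝ) one_lt_two
  have hN : (N : ℝ) ≤ 2 ^ k * M := hk.le.trans (le_mul_of_one_le_right (by positivity) hM.le)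
  calc _ ≤ ∑ p ∈ Finset.range N,
        (if p.Prime ∧ M < (p : ℝ) then Real.log p / (p : ℝ) ^ s else 0) / Real.log M := by
        refine Finset.sum_le_sum fun p _ ↦ ?_
        split_ifs with h
        · rw [div_right_comm]
          gcongr
          rw [one_le_div hlog]
          exact Real.log_le_log hM0 h.2.le
        · simp
    _ ≤ 2 * Real.log 4 / (1 - 2 ^ (1 - s)) * M ^ (1 - s) / Real.log M := by
        rw [← Finset.sum_div]
        gcongr
        exact sum_prime_log_div_rpow_le hs N k hM0 hN
    _ = _ := by
        rw [← neg_sub s 1, Real.rpow_neg hM0.le, ← div_eq_mul_inv, div_div]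

lemma theta_sub_theta_le_mul_tsum_prime_tail {s M x : ℝ} (hs : 1 < s) (hx : 1 ≤ x) :
    Chebyshev.theta x - Chebyshev.theta M ≤ x ^ s * Real.log x *
      ∑' p : ℕ, if p.Prime ∧ M < (p : ℝ) then 1 / (p : ℝ) ^ s else 0 := by
  have hlog : 0 ≤ Real.log x := Real.log_nonneg hx
  set f : ℕ → ℝ := fun p ↦ if p.Prime ∧ M < (p : ℝ) then 1 / (p : ℝ) ^ s else 0 with hf
  have hf0 : ∀ p, 0 ≤ f p := fun p ↦ by simp only [hf]; split_ifs <;> positivity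
  set T := (Finset.Ioc 0 ⌊x⌋₊).filter Nat.Prime with hT
  have hsmall : (∑ p ∈ T, if (p : ℝ) ≤ M then Real.log p else 0) ≤ Chebyshev.theta M := by
    rw [← Finset.sum_filter, Chebyshev.theta]
    refine Finset.sum_le_sum_of_subset_of_nonneg (fun p hp ↦ ?_)
      fun p _ _ ↦ Real.log_natCast_nonneg p
    simp only [hT, Finset.mem_filter, Finset.mem_Ioc] at hp ⊢
    exact ⟨⟨hp.1.1.1, Nat.le_floor hp.2⟩, hp.1.2⟩
  have hpoint : ∀ p ∈ T, Real.log p ≤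
      x ^ s * Real.log x * f p + if (p : ℝ) ≤ M then Real.log p else 0 := by
    intro p hp
    simp only [hT, Finset.mem_filter, Finset.mem_Ioc] at hp
    have hp0 : (0 : ℝ) < p := by exact_mod_cast hp.2.pos
    have hpx : (p : ℝ) ≤ x := (Nat.le_floor_iff (by linarith)).1 hp.1.2
    split_ifs with h
    · exact le_add_of_nonneg_left (mul_nonneg (by positivity) (hf0 p))
    · have hfp : f p = 1 / (p : ℝ) ^ s := if_pos ⟨hp.2, not_le.1 h⟩
      have hpow : 1 ≤ x ^ s / (p : ℝ) ^ s := by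
        rw [one_le_div (by positivity)]
        gcongr
      calc Real.log p ≤ Real.log x := Real.log_le_log hp0 hpx
        _ ≤ Real.log x * (x ^ s / (p : ℝ) ^ s) := le_mul_of_one_le_right hlog hpow
        _ = _ := by rw [hfp]; ring
  have hsum := Finset.sum_le_sum hpoint
  rw [Finset.sum_add_distrib, ← Finset.mul_sum] at hsum
  have htsum : ∑ p ∈ T, f p ≤ ∑' p, f p :=
    (summable_prime_tail_rpow hs M).sum_le_tsum T fun p _ ↦ hf0 p
  have hmul := mul_le_mul_of_nonneg_left htsum (show 0 ≤ x ^ s * Real.log x by positivity)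
  rw [Chebyshev.theta]
  linarith

/-- **Theorem (tail of the prime zeta function).**
For every real `s > 1` there are constants `c₁, c₂ > 0` (depending only on `s`) such that
for every sufficiently large real `M`,
`c₁ / (M^{s-1} log M) ≤ ∑_{p prime, p > M} 1/p^s ≤ c₂ / (M^{s-1} log M)`. -/
theorem primeZeta_tail_asymp (s : ℝ) (hs : 1 < s) :
    ∃ c₁ c₂ : ℝ, 0 < c₁ ∧ 0 < c₂ ∧ ∀ᶠ M : ℝ in atTop,
      c₁ / (M ^ (s - 1) * Real.log M) ≤
        (∑' p : ℕ, if p.Prime ∧ M < (p : ℝ) then 1 / (p : ℝ) ^ s else 0) ∧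
      (∑' p : ℕ, if p.Prime ∧ M < (p : ℝ) then 1 / (p : ℝ) ^ s else 0) ≤
        c₂ / (M ^ (s - 1) * Real.log M) := by
  have hlog2 : 0 < Real.log 2 := Real.log_pos one_lt_two
  have hlog4 : 0 < Real.log 4 := Real.log_pos (by norm_num)
  have hr : 0 < 1 - (2 : ℝ) ^ (1 - s) :=
    sub_pos.2 (Real.rpow_lt_one_of_one_lt_of_neg one_lt_two (by linarith))
  refine ⟨Real.log 2 / 8 ^ s, 2 * Real.log 4 / (1 - 2 ^ (1 - s)), by positivity, by positivity, ?_⟩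
  have htheta := (tendsto_id.const_mul_atTop (show (0 : ℝ) < 8 by norm_num)).eventually
    eventually_mul_log_two_le_theta
  filter_upwards [htheta, eventually_ge_atTop 8] with M hM hM8
  refine ⟨?_, tsum_prime_tail_rpow_le hs (by linarith)⟩
  have hM0 : 0 < M := by linarith
  have hlog : 0 < Real.log M := Real.log_pos (by linarith)
  have hlog8 : Real.log (8 * M) ≤ 2 * Real.log M := by
    rw [Real.log_mul (by norm_num) hM0.ne', two_mul]
    gcongr
  have hlog8' : 0 < Real.log (8 * M) := Real.log_pos (by linarith)
  have hlower := theta_sub_theta_le_mul_tsum_prime_tail (M := M) (x := 8 * M) hs (by linarith)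
  have hupper := Chebyshev.theta_le_log4_mul_x hM0.le
  have h4 : Real.log 4 = 2 * Real.log 2 := by
    rw [show (4 : ℝ) = 2 ^ 2 by norm_num, Real.log_pow]
    norm_num
  rw [h4] at hupper
  simp only [id] at hM
  have hdiff : 2 * Real.log 2 * M ≤ Chebyshev.theta (8 * M) - Chebyshev.theta M := by linarith
  calc Real.log 2 / 8 ^ s / (M ^ (s - 1) * Real.log M)
      = 2 * Real.log 2 * M / ((8 * M) ^ s * (2 * Real.log M)) := by
        rw [Real.mul_rpow (by norm_num) hM0.le, Real.rpow_sub hM0, Real.rpow_one]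
        field_simp
    _ ≤ 2 * Real.log 2 * M / ((8 * M) ^ s * Real.log (8 * M)) := by gcongr
    _ ≤ _ := by
        rw [div_le_iff₀' (by positivity)]
        exact hdiff.trans hlower
end

section
/- For every positive integer ℓ and every function φ : ℕ → (0, ∞), the Hausdorff dimension of E′_ℓ(φ) equals the Hausdorff dimension of E_ℓ(φ). -/
open MeasureTheory Filter Set

/-- The Gauss map `T(x) = 1/x - ⌊1/x⌋` (with `T 0 = 0`). -/
noncomputable def gaussMap (x : ℝ) : ℝ := if x = 0 then 0 else Int.fract x⁻¹

/-- `cfA x n` is the `n`-th partial quotient `a_n(x) = ⌊1 / T^{n-1}(x)⌋` (for `n ≥ 1`). -/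
noncomputable def cfA (x : ℝ) (n : ℕ) : ℕ := ⌊(gaussMap^[n - 1] x)⁻¹⌋₊

/-- `cfA' x n` is `a_n(x)` if it is prime, and `0` otherwise. -/
noncomputable def cfA' (x : ℝ) (n : ℕ) : ℕ := if (cfA x n).Prime then cfA x n else 0

/-- `Eℓ ℓ φ` is the set `E_ℓ(φ)` of irrational `x ∈ [0,1)` such that
`a_n(x) ⋯ a_{n+ℓ-1}(x) ≥ φ(n)` for infinitely many `n ∈ ℕ`. -/
noncomputable def Eℓ (ℓ : ℕ) (φ : ℕ → ℝ) : Set ℝ :=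
  {x | x ∈ Set.Ico (0 : ℝ) 1 ∧ Irrational x ∧
    {n : ℕ | 1 ≤ n ∧ φ n ≤ ∏ i ∈ Finset.range ℓ, (cfA x (n + i) : ℝ)}.Infinite}

/-- `Eprimeℓ ℓ φ` is the set `E′_ℓ(φ)` of irrational `x ∈ [0,1)` such that
`a′_n(x) ⋯ a′_{n+ℓ-1}(x) ≥ φ(n)` for infinitely many `n ∈ ℕ`. -/
noncomputable def Eprimeℓ (ℓ : ℕ) (φ : ℕ → ℝ) : Set ℝ :=
  {x | x ∈ Set.Ico (0 : ℝ) 1 ∧ Irrational x ∧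
    {n : ℕ | 1 ≤ n ∧ φ n ≤ ∏ i ∈ Finset.range ℓ, (cfA' x (n + i) : ℝ)}.Infinite}

/-- `IsCF a u` says that `a` is the sequence of partial quotients of an infinite continued
fraction and that `u k = [a k, a (k + 1), …]` are its tails. -/
structure IsCF (a : ℕ → ℕ) (u : ℕ → ℝ) : Prop where
  one_le : ∀ k, 1 ≤ a k
  pos : ∀ k, 0 < u k
  lt_one : ∀ k, u k < 1
  mul_eq : ∀ k, u k * (a k + u (k + 1)) = 1

theorem gaussMap_of_pos {x : ℝ} (hx : 0 < x) : gaussMap x = Int.fract x⁻¹ := by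
  simp [gaussMap, hx.ne']

theorem Irrational.gaussMap {x : ℝ} (hx : Irrational x) : Irrational (gaussMap x) := by
  have h0 : x ≠ 0 := hx.ne_zero
  simp only [_root_.gaussMap, h0, if_false, Int.fract]
  exact hx.inv.sub_intCast _

theorem isCF_of_irrational {x : ℝ} (hx : x ∈ Ico (0 : ℝ) 1) (hirr : Irrational x) :
    IsCF (fun k ↦ cfA x (k + 1)) (fun k ↦ gaussMap^[k] x) := by
  have hirr' : ∀ k, Irrational (gaussMap^[k] x) := by
    intro k
    induction k with
    | zero => exact hirr
    | succ k ih => rw [Function.iterate_succ_apply']; exact ih.gaussMap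
  have hIco : ∀ k, gaussMap^[k] x ∈ Ico (0 : ℝ) 1 := by
    intro k
    cases k with
    | zero => exact hx
    | succ k =>
      rw [Function.iterate_succ_apply', gaussMap, if_neg (hirr' k).ne_zero]
      exact ⟨Int.fract_nonneg _, Int.fract_lt_one _⟩
  have hpos : ∀ k, 0 < gaussMap^[k] x := fun k ↦
    lt_of_le_of_ne (hIco k).1 (hirr' k).ne_zero.symm
  refine ⟨fun k ↦ ?_, hpos, fun k ↦ (hIco k).2, fun k ↦ ?_⟩
  · simp only [cfA, Nat.add_sub_cancel]
    exact Nat.le_floor (by simpa using ((one_le_inv₀ (hpos k)).2 (hIco k).2.le))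
  · simp only [cfA, Nat.add_sub_cancel, Function.iterate_succ_apply']
    rw [gaussMap_of_pos (hpos k), natCast_floor_eq_intCast_floor (inv_pos.2 (hpos k)).le,
      Int.floor_add_fract, mul_inv_cancel₀ (hpos k).ne']

namespace IsCF

variable {a : ℕ → ℕ} {u : ℕ → ℝ}

theorem inv_eq (h : IsCF a u) (k : ℕ) : (u k)⁻¹ = a k + u (k + 1) :=
  inv_eq_of_mul_eq_one_right (h.mul_eq k)

theorem gaussMap_eq (h : IsCF a u) (k : ℕ) : gaussMap (u k) = u (k + 1) := by
  rw [gaussMap_of_pos (h.pos k), h.inv_eq, Int.fract_natCast_add,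
    Int.fract_eq_self.2 ⟨(h.pos _).le, h.lt_one _⟩]

theorem iterate_eq (h : IsCF a u) (k : ℕ) : gaussMap^[k] (u 0) = u k := by
  induction k with
  | zero => rfl
  | succ k ih => rw [Function.iterate_succ_apply', ih, h.gaussMap_eq]

theorem cfA_eq (h : IsCF a u) (k : ℕ) : cfA (u 0) (k + 1) = a k := by
  rw [cfA, Nat.add_sub_cancel, h.iterate_eq, h.inv_eq, Nat.floor_eq_iff]
  · exact ⟨by linarith [h.pos (k + 1)], by linarith [h.lt_one (k + 1)]⟩
  · have := h.pos (k + 1)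
    positivity

theorem ne_div (h : IsCF a u) : ∀ (q p k : ℕ), u k ≠ p / q := by
  intro q
  induction q using Nat.strong_induction_on with
  | _ q ih =>
    intro p k hk
    have hpos := h.pos k
    have hlt := h.lt_one k
    have hq : (0 : ℝ) < q := by
      rcases Nat.eq_zero_or_pos q with rfl | hq
      · simp [hk] at hpos
      · exact_mod_cast hq
    have hp : (0 : ℝ) < p := by
      rcases Nat.eq_zero_or_pos p with rfl | hp
      · simp [hk] at hpos
      · exact_mod_cast hp
    have hpq : p < q := by
      rw [hk, div_lt_one hq] at hlt
      exact_mod_cast hlt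
    have hinv := h.inv_eq k
    rw [hk, inv_div] at hinv
    have hu : u (k + 1) = ((q : ℝ) - a k * p) / p := by
      field_simp at hinv ⊢
      linarith
    have hle : a k * p ≤ q := by
      have h1 := h.pos (k + 1)
      rw [hu, div_pos_iff_of_pos_right hp, sub_pos] at h1
      exact_mod_cast h1.le
    refine ih p hpq (q - a k * p) (k + 1) ?_
    rw [hu]
    push_cast [Nat.cast_sub hle]
    rfl

theorem irrational (h : IsCF a u) (k : ℕ) : Irrational (u k) := by
  rintro ⟨r, hr⟩
  have hr0 : 0 ≤ r := by
    have := (h.pos k).le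
    rw [← hr] at this
    exact_mod_cast this
  refine h.ne_div r.den r.num.toNat k ?_
  rw [← hr]
  have h1 : ((r.num.toNat : ℕ) : ℝ) = (r.num : ℝ) := by
    exact_mod_cast congrArg (Int.cast (R := ℝ)) (Int.toNat_of_nonneg (Rat.num_nonneg.2 hr0))
  rw [h1, Rat.cast_def]

end IsCF

/-- The points of `[0, 1]` whose continued fraction expansion begins with the first `n` terms
of `a`. -/
def cfCyl : ℕ → (ℕ → ℕ) → Set ℝ
  | 0, _ => Icc 0 1
  | n + 1, a => (fun w : ℝ ↦ (a 0 + w)⁻¹) '' cfCyl n fun k ↦ a (k + 1)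

theorem cfCyl_subset_Icc (n : ℕ) : ∀ a : ℕ → ℕ, (∀ k, 1 ≤ a k) → cfCyl n a ⊆ Icc 0 1 := by
  induction n with
  | zero => intro a _; exact subset_rfl
  | succ n ih =>
    rintro a ha _ ⟨w, hw, rfl⟩
    have hw' := ih _ (fun k ↦ ha (k + 1)) hw
    have h1 : (1 : ℝ) ≤ a 0 := by exact_mod_cast ha 0
    exact ⟨by have := hw'.1; positivity, inv_le_one_of_one_le₀ (by linarith [hw'.1])⟩

theorem cfCyl_nonempty (n : ℕ) : ∀ a : ℕ → ℕ, (cfCyl n a).Nonempty := by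
  induction n with
  | zero => intro a; exact ⟨0, by simp [cfCyl]⟩
  | succ n ih => intro a; exact (ih _).image _

theorem isCompact_cfCyl (n : ℕ) : ∀ a : ℕ → ℕ, (∀ k, 1 ≤ a k) → IsCompact (cfCyl n a) := by
  induction n with
  | zero => intro a _; exact isCompact_Icc
  | succ n ih =>
    intro a ha
    refine (ih _ fun k ↦ ha (k + 1)).image_of_continuousOn ?_
    refine ContinuousOn.inv₀ (by fun_prop) fun w hw ↦ ?_
    have hw' := cfCyl_subset_Icc n _ (fun k ↦ ha (k + 1)) hw
    have h1 : (1 : ℝ) ≤ a 0 := by exact_mod_cast ha 0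
    linarith [hw'.1]

theorem cfCyl_succ_subset (n : ℕ) :
    ∀ a : ℕ → ℕ, (∀ k, 1 ≤ a k) → cfCyl (n + 1) a ⊆ cfCyl n a := by
  induction n with
  | zero => exact cfCyl_subset_Icc 1
  | succ n ih => intro a ha; exact image_mono (ih _ fun k ↦ ha (k + 1))

theorem tail_mem_cfCyl {a : ℕ → ℕ} {y : ℝ} (hy : ∀ n, y ∈ cfCyl n a)
    (n : ℕ) : y⁻¹ - a 0 ∈ cfCyl n fun k ↦ a (k + 1) := by
  obtain ⟨w, hw, rfl⟩ := hy (n + 1)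
  simpa using hw

theorem exists_isCF {a : ℕ → ℕ} (ha : ∀ k, 1 ≤ a k) : ∃ u, IsCF a u := by
  obtain ⟨y, hy⟩ := IsCompact.nonempty_iInter_of_sequence_nonempty_isCompact_isClosed
    (fun n ↦ cfCyl n a) (fun n ↦ cfCyl_succ_subset n a ha) (fun n ↦ cfCyl_nonempty n a)
    (isCompact_cfCyl 0 a ha) (fun n ↦ (isCompact_cfCyl n a ha).isClosed)
  rw [mem_iInter] at hy
  let u : ℕ → ℝ := fun k ↦ Nat.rec y (fun k w ↦ w⁻¹ - a k) k
  have hu : ∀ k, u (k + 1) = (u k)⁻¹ - a k := fun k ↦ rfl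
  have hmem : ∀ k n, u k ∈ cfCyl n fun j ↦ a (j + k) := by
    intro k
    induction k with
    | zero => exact hy
    | succ k ih =>
      intro n
      have := tail_mem_cfCyl ih n
      simp only [Nat.zero_add] at this
      have hidx : (fun j ↦ a (j + 1 + k)) = fun j ↦ a (j + (k + 1)) := by
        funext j
        congr 1
        omega
      rwa [hidx] at this
  have hIcc : ∀ k, u k ∈ Icc (0 : ℝ) 1 := fun k ↦ hmem k 0
  have hpos : ∀ k, 0 < u k := by
    intro k
    obtain ⟨w, hw, hwk⟩ := hmem k 1
    rw [← hwk]
    have h1 : (1 : ℝ) ≤ a (0 + k) := by exact_mod_cast ha _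
    have := hw.1
    positivity
  have heq : ∀ k, (u k)⁻¹ = a k + u (k + 1) := fun k ↦ by rw [hu]; ring
  refine ⟨u, ha, hpos, fun k ↦ ?_, fun k ↦ ?_⟩
  · have h1 : (1 : ℝ) ≤ a k := by exact_mod_cast ha _
    have h2 : 1 < (u k)⁻¹ := by rw [heq]; linarith [hpos (k + 1)]
    exact (one_lt_inv₀ (hpos k)).1 h2
  · rw [← heq, mul_inv_cancel₀ (hpos k).ne']

theorem nth_prime_le_rpow {ε : ℝ} (hε : 0 < ε) :
    ∃ A : ℝ, 1 ≤ A ∧ ∀ n : ℕ, 1 ≤ n → (Nat.nth Nat.Prime n : ℝ) ≤ A * (n : ℝ) ^ (1 + ε) := by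
  set η : ℝ := ε / (1 + ε) with hη
  have hη0 : 0 < η := by positivity
  have hη1 : (1 - η) * (1 + ε) = 1 := by rw [hη]; field_simp; ring
  have hlog2 : 0 < Real.log 2 := Real.log_pos (by norm_num)
  set D : ℝ := 4 / (η * Real.log 2) with hD
  have hD0 : 0 < D := by positivity
  refine ⟨max 1 (D ^ (1 + ε)), le_max_left _ _, fun n hn ↦ ?_⟩
  have hn1 : (1 : ℝ) ≤ n := by exact_mod_cast hn
  set p := Nat.nth Nat.Prime n with hp
  have hprime : p.Prime := Nat.prime_nth_prime n
  have hp2 : (2 : ℝ) ≤ p := by exact_mod_cast hprime.two_le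
  have hp0 : (0 : ℝ) < p := by linarith
  have hlogp : 0 < Real.log p := Real.log_pos (by linarith)
  have hcount : Nat.primeCounting p = n + 1 := by
    rw [Nat.primeCounting, Nat.primeCounting', Nat.count_succ, hp,
      Nat.count_nth_of_infinite Nat.infinite_setOfPred_prime, if_pos hprime]
  have h1 := Chebyshev.pi_ge p
  rw [hcount, div_le_iff₀ hlogp] at h1
  push_cast at h1
  have h2 : Real.log (p + 1) ≤ 2 * Real.log p := by
    rw [← Real.log_rpow hp0 2]
    refine Real.log_le_log (by linarith) ?_
    norm_cast
    nlinarith [hprime.two_le]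
  have h3 : Real.log p ≤ (p : ℝ) ^ η / η := Real.log_le_rpow_div hp0.le hη0
  have h4 : (p : ℝ) * Real.log 2 ≤ 4 * n * ((p : ℝ) ^ η / η) := by nlinarith
  have h5 : (p : ℝ) ≤ D * n * (p : ℝ) ^ η := by
    have : D * n * (p : ℝ) ^ η = 4 * n * ((p : ℝ) ^ η / η) / Real.log 2 := by
      rw [hD]; field_simp
    rw [this, le_div_iff₀ hlog2]
    exact h4
  have h6 : (p : ℝ) ^ (1 - η) ≤ D * n := by
    rw [Real.rpow_sub hp0, Real.rpow_one, div_le_iff₀ (by positivity)]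
    exact h5
  have h7 : ((p : ℝ) ^ (1 - η)) ^ (1 + ε) ≤ (D * n) ^ (1 + ε) :=
    Real.rpow_le_rpow (by positivity) h6 (by positivity)
  rw [← Real.rpow_mul hp0.le, hη1, Real.rpow_one, Real.mul_rpow hD0.le (by positivity)] at h7
  exact h7.trans (mul_le_mul_of_nonneg_right (le_max_right _ _) (by positivity))

/-- The denominators of the convergents of the continued fraction with partial quotients `a`,
shifted by one: `cfDen a (n + 1) = a (n - 1) * cfDen a n + cfDen a (n - 1)`. -/
def cfDen (a : ℕ → ℕ) : ℕ → ℝ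
  | 0 => 0
  | 1 => 1
  | n + 2 => a n * cfDen a (n + 1) + cfDen a n

theorem cfDen_nonneg (a : ℕ → ℕ) : ∀ n, 0 ≤ cfDen a n
  | 0 => le_rfl
  | 1 => zero_le_one
  | n + 2 => by
    have h1 := cfDen_nonneg a (n + 1)
    have h2 := cfDen_nonneg a n
    rw [cfDen]
    positivity

theorem one_le_cfDen {a : ℕ → ℕ} (ha : ∀ k, 1 ≤ a k) (n : ℕ) : 1 ≤ cfDen a (n + 1) := by
  induction n with
  | zero => exact le_rfl
  | succ n ih =>
    have h1 : (1 : ℝ) ≤ a n := by exact_mod_cast ha n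
    rw [cfDen]
    nlinarith [cfDen_nonneg a n]

theorem cfDen_le_succ {a : ℕ → ℕ} (ha : ∀ k, 1 ≤ a k) (n : ℕ) : cfDen a n ≤ cfDen a (n + 1) := by
  cases n with
  | zero => exact zero_le_one
  | succ n =>
    have h1 : (1 : ℝ) ≤ a n := by exact_mod_cast ha n
    rw [cfDen]
    nlinarith [cfDen_nonneg a n, cfDen_nonneg a (n + 1)]

theorem two_pow_le_cfDen_sq {a : ℕ → ℕ} (ha : ∀ k, 1 ≤ a k) :
    ∀ n, (2 : ℝ) ^ n ≤ 2 * cfDen a (n + 1) ^ 2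
  | 0 => by norm_num [cfDen]
  | 1 => by
    have := one_le_cfDen ha 1
    simp only [Nat.reduceAdd] at this ⊢
    nlinarith
  | n + 2 => by
    have ih := two_pow_le_cfDen_sq ha n
    have h1 : (1 : ℝ) ≤ a (n + 1) := by exact_mod_cast ha _
    have h2 := cfDen_le_succ ha (n + 1)
    have h3 := cfDen_nonneg a (n + 1)
    have h4 : 2 * cfDen a (n + 1) ≤ cfDen a (n + 2 + 1) := by
      rw [cfDen]
      nlinarith
    rw [pow_add]
    nlinarith

theorem IsCF.prod_mul_eq {a : ℕ → ℕ} {u : ℕ → ℝ} (h : IsCF a u) (n : ℕ) :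
    (∏ k ∈ Finset.range n, u k) * (cfDen a (n + 1) + u n * cfDen a n) = 1 := by
  induction n with
  | zero => simp [cfDen]
  | succ n ih =>
    rw [Finset.prod_range_succ, ← ih, cfDen, mul_assoc]
    congr 1
    linear_combination cfDen a (n + 1) * h.mul_eq n

theorem IsCF.prod_pos {a : ℕ → ℕ} {u : ℕ → ℝ} (h : IsCF a u) (n : ℕ) :
    0 < ∏ k ∈ Finset.range n, u k :=
  Finset.prod_pos fun k _ ↦ h.pos k

theorem IsCF.prod_mul_cfDen_le {a : ℕ → ℕ} {u : ℕ → ℝ} (h : IsCF a u) (n : ℕ) :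
    (∏ k ∈ Finset.range n, u k) * cfDen a (n + 1) ≤ 1 := by
  rw [← h.prod_mul_eq n]
  have := h.prod_pos n
  have := h.pos n
  have := cfDen_nonneg a n
  gcongr
  nlinarith

theorem IsCF.one_le_prod_mul_cfDen {a : ℕ → ℕ} {u : ℕ → ℝ} (h : IsCF a u) (n : ℕ) :
    1 ≤ (∏ k ∈ Finset.range n, u k) * (2 * cfDen a (n + 1)) := by
  rw [← h.prod_mul_eq n]
  have := h.prod_pos n
  have := h.lt_one n
  have := cfDen_nonneg a n
  have := cfDen_le_succ h.one_le n
  gcongr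
  nlinarith

/-- Points sharing their first `n` partial quotients. -/
theorem IsCF.abs_sub_eq {a a' : ℕ → ℕ} {u u' : ℕ → ℝ} (h : IsCF a u) (h' : IsCF a' u') {n : ℕ}
    (haa : ∀ k < n, a k = a' k) :
    |u 0 - u' 0| = |u n - u' n| * ((∏ k ∈ Finset.range n, u k) * ∏ k ∈ Finset.range n, u' k) := by
  induction n with
  | zero => simp
  | succ n ih =>
    rw [ih fun k hk ↦ haa k (by omega), Finset.prod_range_succ, Finset.prod_range_succ]
    have h1 := h.mul_eq n
    have h2 := h'.mul_eq n
    rw [← haa n (by omega)] at h2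
    have h3 : u n - u' n = -(u (n + 1) - u' (n + 1)) * (u n * u' n) := by
      linear_combination u' n * h1 - u n * h2
    rw [h3, abs_mul, abs_neg, abs_of_pos (mul_pos (h.pos n) (h'.pos n))]
    ring

theorem IsCF.head_eq {a : ℕ → ℕ} {u u' : ℕ → ℝ} (h : IsCF a u) (h' : IsCF a u') :
    u 0 = u' 0 := by
  have key : ∀ n : ℕ, |u 0 - u' 0| ≤ 2 * (1 / 2) ^ n := by
    intro n
    rw [h.abs_sub_eq h' (n := n) fun _ _ ↦ rfl]
    have hq := two_pow_le_cfDen_sq h.one_le n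
    have hq1 := one_le_cfDen h.one_le n
    have hp : ∀ {v}, IsCF a v → ∏ k ∈ Finset.range n, v k ≤ (cfDen a (n + 1))⁻¹ := by
      intro v hv
      rw [← one_div, le_div_iff₀ (by linarith)]
      exact hv.prod_mul_cfDen_le n
    have h1 : |u n - u' n| ≤ 1 := by
      rw [abs_le]
      constructor <;> linarith [h.pos n, h.lt_one n, h'.pos n, h'.lt_one n]
    calc _ ≤ 1 * ((cfDen a (n + 1))⁻¹ * (cfDen a (n + 1))⁻¹) := by
          have := h.prod_pos n
          have := h'.prod_pos n
          gcongr
          · exact hp h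
          · exact hp h'
      _ = 1 / cfDen a (n + 1) ^ 2 := by rw [one_mul, ← mul_inv, one_div, sq]
      _ ≤ 2 * (1 / 2) ^ n := by
          rw [div_pow, one_pow, div_le_iff₀ (by positivity), mul_one_div, div_mul_eq_mul_div,
            le_div_iff₀ (by positivity)]
          linarith
  have hlim : Tendsto (fun n : ℕ ↦ 2 * (1 / 2 : ℝ) ^ n) atTop (nhds (2 * 0)) :=
    (tendsto_pow_atTop_nhds_zero_of_lt_one (by norm_num) (by norm_num)).const_mul 2
  have := ge_of_tendsto' hlim key
  rw [mul_zero, abs_nonpos_iff] at this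
  linarith

/-- Data of two continued fractions, the second being obtained from the first by applying the
digit maps `m k`, which increase digits at most polynomially. -/
structure IsCFPair (m : ℕ → ℕ → ℕ) (A κ : ℝ) (a : ℕ → ℕ) (u v : ℕ → ℝ) : Prop where
  left : IsCF a u
  right : IsCF (fun k ↦ m k (a k)) v
  le : ∀ k, (m k (a k) : ℝ) ≤ A * (a k : ℝ) ^ κ

namespace IsCFPair

variable {m : ℕ → ℕ → ℕ} {A κ : ℝ} {a a' : ℕ → ℕ} {u v u' v' : ℕ → ℝ}

theorem rpow_le (h : IsCFPair m A κ a u v) (hκ : 1 ≤ κ) (hA : 1 ≤ A) (k : ℕ) :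
    u k ^ κ ≤ 2 * A * v k := by
  have hu := h.left.pos k
  have hv := h.right.pos k
  have hua : u k * a k ≤ 1 := by
    rw [← h.left.mul_eq k]
    have := h.left.pos (k + 1)
    nlinarith
  have hb : (1 : ℝ) ≤ m k (a k) := by exact_mod_cast h.right.one_le k
  calc u k ^ κ = u k ^ κ * (v k * (m k (a k) + v (k + 1))) := by
        rw [h.right.mul_eq k, mul_one]
    _ ≤ u k ^ κ * (v k * (2 * (A * (a k : ℝ) ^ κ))) := by
        have := h.right.lt_one (k + 1)
        have := h.le k
        gcongr
        linarith
    _ = 2 * A * v k * (u k * a k) ^ κ := by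
        rw [Real.mul_rpow hu.le (by positivity)]
        ring
    _ ≤ 2 * A * v k * 1 := by
        gcongr
        exact Real.rpow_le_one (by positivity) hua (by linarith)
    _ = 2 * A * v k := mul_one _

theorem one_sub_rpow_le (h : IsCFPair m A κ a u v) (hm : ∀ k, StrictMono (m k)) (hκ : 1 ≤ κ)
    (hA : 1 ≤ A) (k : ℕ) : (1 - u k) ^ κ ≤ 4 * A * (1 - v k) := by
  have hu := h.left.pos k
  have hu1 := h.left.lt_one k
  have hv := h.right.pos k
  have hv1 := h.right.lt_one k
  have hv' := h.right.pos (k + 1)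
  have hv1' := h.right.lt_one (k + 1)
  have hu' := h.left.pos (k + 1)
  have heq := h.right.mul_eq k
  have heq' := h.left.mul_eq k
  by_cases hb : 2 ≤ m k (a k)
  · have hb' : (2 : ℝ) ≤ m k (a k) := by exact_mod_cast hb
    have h1 : v k * 2 ≤ 1 := by nlinarith
    have h2 : (1 - u k) ^ κ ≤ 1 :=
      Real.rpow_le_one (by linarith) (by linarith) (by linarith)
    nlinarith
  · have hb1 : m k (a k) = 1 := by
      have := h.right.one_le k
      omega
    have ha1 : a k = 1 := by
      have h1 := h.left.one_le k
      have h2 := (hm k).le_apply (x := a k)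
      omega
    simp only [hb1, Nat.cast_one] at heq
    rw [ha1, Nat.cast_one] at heq'
    have h3 : 1 - u k ≤ u (k + 1) := by nlinarith
    have h4 : v (k + 1) ≤ 2 * (1 - v k) := by nlinarith
    calc (1 - u k) ^ κ ≤ u (k + 1) ^ κ := by
          exact Real.rpow_le_rpow (by linarith) h3 (by linarith)
      _ ≤ 2 * A * v (k + 1) := h.rpow_le hκ hA (k + 1)
      _ ≤ 2 * A * (2 * (1 - v k)) := by gcongr
      _ = 4 * A * (1 - v k) := by ring

theorem rpow_sub_le (h : IsCFPair m A κ a u v) (h' : IsCFPair m A κ a' u' v')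
    (hm : ∀ k, StrictMono (m k)) (hκ : 1 ≤ κ) (hA : 1 ≤ A) {n : ℕ} (hn : a n < a' n) :
    |u n - u' n| ^ (2 * κ - 1) ≤ 16 * 2 ^ κ * A ^ 3 * |v n - v' n| := by
  have hA0 : 0 ≤ A := by linarith
  have hu := h.left.pos n
  have hu1 := h.left.lt_one n
  have hv := h.right.pos n
  have hu' := h'.left.pos n
  have hv' := h'.right.pos n
  have w0 := h.left.pos (n + 1)
  have w1 := h.left.lt_one (n + 1)
  have w0' := h'.left.pos (n + 1)
  have w1' := h'.left.lt_one (n + 1)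
  have z0 := h.right.pos (n + 1)
  have z1 := h.right.lt_one (n + 1)
  have z0' := h'.right.pos (n + 1)
  have z1' := h'.right.lt_one (n + 1)
  have hcv : u n ^ κ ≤ 2 * A * v n := h.rpow_le hκ hA n
  have hcv' : u' n ^ κ ≤ 2 * A * v' n := h'.rpow_le hκ hA n
  have hC : 24 * A ^ 2 ≤ 16 * 2 ^ κ * A ^ 3 ∧ 4 * A ≤ 16 * 2 ^ κ * A ^ 3 := by
    have h2 : (2 : ℝ) ≤ 2 ^ κ := by
      simpa using Real.rpow_le_rpow_of_exponent_le (one_le_two (α := ℝ)) hκ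
    have h3 : A ^ 2 ≤ A ^ 3 := pow_le_pow_right₀ hA (by norm_num)
    have h4 : A ≤ A ^ 3 := le_self_pow₀ hA (by norm_num)
    constructor <;> nlinarith
  set Dt : ℝ := (a' n + u' (n + 1)) - (a n + u (n + 1)) with hDt
  set Ds : ℝ := (m n (a' n) + v' (n + 1)) - (m n (a n) + v (n + 1)) with hDs
  have hut : u n - u' n = u n * u' n * Dt := by
    linear_combination u' n * h.left.mul_eq n - u n * h'.left.mul_eq n
  have hvs : v n - v' n = v n * v' n * Ds := by
    linear_combination v' n * h.right.mul_eq n - v n * h'.right.mul_eq n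
  have hdig : (a n : ℝ) + 1 ≤ a' n := by exact_mod_cast hn
  have hdig' : (m n (a n) : ℝ) + 1 ≤ m n (a' n) := by exact_mod_cast hm n hn
  have hDt0 : 0 < Dt := by linarith
  have hDs0 : 0 < Ds := by linarith
  have hdu0 : 0 < u n - u' n := by rw [hut]; positivity
  have hdv0 : 0 < v n - v' n := by rw [hvs]; positivity
  rw [abs_of_pos hdu0, abs_of_pos hdv0]
  by_cases hcase : v' n ≤ v n / 2
  · calc (u n - u' n) ^ (2 * κ - 1) ≤ u n ^ (2 * κ - 1) :=
          Real.rpow_le_rpow hdu0.le (by linarith) (by linarith)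
      _ ≤ u n ^ κ := Real.rpow_le_rpow_of_exponent_ge hu hu1.le (by linarith)
      _ ≤ 2 * A * v n := hcv
      _ ≤ 4 * A * (v n - v' n) := by nlinarith
      _ ≤ _ := mul_le_mul_of_nonneg_right hC.2 hdv0.le
  push Not at hcase
  by_cases hadj : m n (a n) + 1 = m n (a' n)
  · have hadj' : a' n = a n + 1 := by
      by_contra hne
      have h1 := hm n (show a n < a n + 1 by omega)
      have h2 := hm n (show a n + 1 < a' n by omega)
      omega
    have hDt' : Dt = (1 - u (n + 1)) + u' (n + 1) := by
      rw [hDt, hadj']; push_cast; ring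
    have hDs' : Ds = (1 - v (n + 1)) + v' (n + 1) := by
      rw [hDs, ← hadj]; push_cast; ring
    have hmax : Dt ^ κ ≤ 2 ^ κ * (4 * A * Ds) := by
      have h1 := h.one_sub_rpow_le hm hκ hA (n + 1)
      have h2 := h'.rpow_le hκ hA (n + 1)
      have h3 : 0 ≤ (1 - u (n + 1)) ^ κ := Real.rpow_nonneg (by linarith) _
      have h4 : 0 ≤ u' (n + 1) ^ κ := Real.rpow_nonneg w0'.le _
      have h5 : (max (1 - u (n + 1)) (u' (n + 1))) ^ κ ≤ 4 * A * Ds := by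
        rw [hDs']
        rcases max_cases (1 - u (n + 1)) (u' (n + 1)) with ⟨h6, -⟩ | ⟨h6, -⟩
        · rw [h6]; nlinarith
        · rw [h6]; nlinarith
      calc Dt ^ κ ≤ (2 * max (1 - u (n + 1)) (u' (n + 1))) ^ κ := by
            refine Real.rpow_le_rpow hDt0.le ?_ (by linarith)
            rw [hDt']
            linarith [le_max_left (1 - u (n + 1)) (u' (n + 1)),
              le_max_right (1 - u (n + 1)) (u' (n + 1))]
        _ = 2 ^ κ * (max (1 - u (n + 1)) (u' (n + 1))) ^ κ :=
            Real.mul_rpow (by norm_num) (le_max_of_le_right w0'.le)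
        _ ≤ _ := by gcongr
    calc (u n - u' n) ^ (2 * κ - 1) ≤ (u n - u' n) ^ κ :=
          Real.rpow_le_rpow_of_exponent_ge hdu0 (by linarith) (by linarith)
      _ = u n ^ κ * u' n ^ κ * Dt ^ κ := by
          rw [hut, Real.mul_rpow (by positivity) hDt0.le, Real.mul_rpow hu.le hu'.le]
      _ ≤ (2 * A * v n) * (2 * A * v' n) * (2 ^ κ * (4 * A * Ds)) := by gcongr
      _ = 16 * 2 ^ κ * A ^ 3 * (v n - v' n) := by rw [hvs]; ring
  · have hgap : (m n (a n) : ℝ) + 2 ≤ m n (a' n) := by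
      have := hm n hn
      have : m n (a n) + 2 ≤ m n (a' n) := by omega
      exact_mod_cast this
    have hdd : (a' n : ℝ) - a n ≤ m n (a' n) - m n (a n) := by
      have := (hm n).add_le_nat (a' n - a n) (a n)
      rw [Nat.sub_add_cancel hn.le] at this
      have h3 : (a' n - a n) + m n (a n) ≤ m n (a' n) := by omega
      have h4 : ((a' n - a n + m n (a n) : ℕ) : ℝ) ≤ m n (a' n) := by exact_mod_cast h3
      rw [Nat.cast_add, Nat.cast_sub hn.le] at h4
      linarith
    have hD : Dt ≤ 3 * Ds := by linarith
    have hpow : u n ^ (2 * κ - 1 - 1) * u n ^ 2 = (u n ^ κ) ^ 2 := by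
      rw [← Real.rpow_natCast, ← Real.rpow_natCast, ← Real.rpow_mul hu.le, ← Real.rpow_add hu]
      congr 1
      push_cast
      ring
    calc (u n - u' n) ^ (2 * κ - 1) = (u n - u' n) ^ (2 * κ - 1 - 1) * (u n - u' n) := by
          rw [← Real.rpow_add_one hdu0.ne', sub_add_cancel]
      _ ≤ u n ^ (2 * κ - 1 - 1) * (u n * u n * (3 * Ds)) := by
          refine mul_le_mul (Real.rpow_le_rpow hdu0.le (by linarith) (by linarith)) ?_ hdu0.le
            (by positivity)
          rw [hut]
          have : u' n ≤ u n := by linarith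
          gcongr
      _ = 3 * (u n ^ κ) ^ 2 * Ds := by rw [← hpow]; ring
      _ ≤ 3 * (2 * A * v n) ^ 2 * Ds := by gcongr
      _ = 12 * A ^ 2 * (v n * v n * Ds) := by ring
      _ ≤ 12 * A ^ 2 * (v n * (2 * v' n) * Ds) := by gcongr; linarith
      _ = 24 * A ^ 2 * (v n - v' n) := by rw [hvs]; ring
      _ ≤ _ := mul_le_mul_of_nonneg_right hC.1 hdv0.le

theorem prod_rpow_le (h : IsCFPair m A κ a u v) {B : ℝ} (hκ : 1 ≤ κ) (hB : 0 ≤ B) {n : ℕ}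
    (hq : cfDen (fun k ↦ m k (a k)) (n + 1) ≤ B * cfDen a (n + 1) ^ κ) :
    (∏ k ∈ Finset.range n, u k) ^ (2 * κ - 1) ≤ 2 * B * ∏ k ∈ Finset.range n, v k := by
  have hP := h.left.prod_pos n
  have hR := h.right.prod_pos n
  have hqa := one_le_cfDen h.left.one_le n
  have hPq := h.left.prod_mul_cfDen_le n
  have hP1 : ∏ k ∈ Finset.range n, u k ≤ 1 := by nlinarith
  set P := ∏ k ∈ Finset.range n, u k
  set Q := ∏ k ∈ Finset.range n, v k
  calc P ^ (2 * κ - 1) ≤ P ^ κ := Real.rpow_le_rpow_of_exponent_ge hP hP1 (by linarith)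
    _ ≤ P ^ κ * (Q * (2 * cfDen (fun k ↦ m k (a k)) (n + 1))) :=
        le_mul_of_one_le_right (by positivity) (h.right.one_le_prod_mul_cfDen n)
    _ ≤ P ^ κ * (Q * (2 * (B * cfDen a (n + 1) ^ κ))) := by gcongr
    _ = 2 * B * Q * (P * cfDen a (n + 1)) ^ κ := by
        rw [Real.mul_rpow hP.le (by linarith)]; ring
    _ ≤ 2 * B * Q * 1 := by
        gcongr
        exact Real.rpow_le_one (by positivity) hPq (by linarith)
    _ = 2 * B * Q := mul_one _

theorem rpow_abs_sub_le (h : IsCFPair m A κ a u v) (h' : IsCFPair m A κ a' u' v')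
    (hm : ∀ k, StrictMono (m k)) (hκ : 1 ≤ κ) (hA : 1 ≤ A) {B : ℝ} (hB : 0 ≤ B)
    (hq : ∀ n, cfDen (fun k ↦ m k (a k)) (n + 1) ≤ B * cfDen a (n + 1) ^ κ)
    (hq' : ∀ n, cfDen (fun k ↦ m k (a' k)) (n + 1) ≤ B * cfDen a' (n + 1) ^ κ) :
    |u 0 - u' 0| ^ (2 * κ - 1) ≤ 16 * 2 ^ κ * A ^ 3 * (2 * B) ^ 2 * |v 0 - v' 0| := by
  by_cases haa : a = a'
  · subst haa
    rw [h.left.head_eq h'.left, sub_self, abs_zero, Real.zero_rpow (by linarith)]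
    positivity
  have hex : ∃ n, a n ≠ a' n := Function.ne_iff.1 haa
  classical
  have hne := Nat.find_spec hex
  have heq : ∀ k < Nat.find hex, a k = a' k := fun k hk ↦ not_not.1 (Nat.find_min hex hk)
  set n := Nat.find hex
  have hloc : |u n - u' n| ^ (2 * κ - 1) ≤ 16 * 2 ^ κ * A ^ 3 * |v n - v' n| := by
    rcases lt_or_gt_of_ne hne with hlt | hlt
    · exact h.rpow_sub_le h' hm hκ hA hlt
    · rw [abs_sub_comm, abs_sub_comm (v n)]
      exact h'.rpow_sub_le h hm hκ hA hlt
  have hP := h.left.prod_pos n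
  have hP' := h'.left.prod_pos n
  have hR := h.right.prod_pos n
  rw [h.left.abs_sub_eq h'.left heq,
    h.right.abs_sub_eq h'.right (n := n) fun k hk ↦ by rw [heq k hk],
    Real.mul_rpow (abs_nonneg _) (by positivity), Real.mul_rpow hP.le hP'.le]
  calc _ ≤ (16 * 2 ^ κ * A ^ 3 * |v n - v' n|) *
        ((2 * B * ∏ k ∈ Finset.range n, v k) * (2 * B * ∏ k ∈ Finset.range n, v' k)) := by
        gcongr
        · exact h.prod_rpow_le hκ hB (hq n)
        · exact h'.prod_rpow_le hκ hB (hq' n)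
    _ = _ := by ring

end IsCFPair

theorem cfDen_le_pow_count_mul {a b : ℕ → ℕ} {M : ℕ → Prop} [DecidablePred M] {A κ : ℝ}
    (hA : 1 ≤ A) (hκ : 1 ≤ κ) (hM : ∀ k, M k → (b k : ℝ) ≤ A * (a k : ℝ) ^ κ)
    (hM' : ∀ k, ¬ M k → (b k : ℝ) ≤ (a k : ℝ) ^ κ) :
    ∀ n, cfDen b n ≤ A ^ Nat.count M (n - 1) * cfDen a n ^ κ
  | 0 => by simp only [cfDen]; positivity
  | 1 => by simp [cfDen]
  | n + 2 => by
    have ih1 := cfDen_le_pow_count_mul hA hκ hM hM' (n + 1)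
    have ih2 := cfDen_le_pow_count_mul hA hκ hM hM' n
    have h1 := cfDen_nonneg a (n + 1)
    have h2 := cfDen_nonneg a n
    have h3 := cfDen_nonneg b (n + 1)
    simp only [Nat.add_sub_cancel] at ih1
    have hcount : A ^ Nat.count M (n - 1) ≤ A ^ Nat.count M (n + 1) :=
      pow_le_pow_right₀ hA (Nat.count_monotone M (by omega))
    have hstep : (b n : ℝ) * A ^ Nat.count M n ≤ A ^ Nat.count M (n + 1) * (a n : ℝ) ^ κ := by
      by_cases hn : M n
      · rw [Nat.count_succ, if_pos hn, pow_succ]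
        calc (b n : ℝ) * A ^ Nat.count M n ≤ (A * (a n : ℝ) ^ κ) * A ^ Nat.count M n := by
              gcongr
              exact hM n hn
          _ = _ := by ring
      · rw [Nat.count_succ, if_neg hn, add_zero, mul_comm]
        gcongr
        exact hM' n hn
    rw [cfDen, cfDen, show n + 2 - 1 = n + 1 by omega]
    calc (b n : ℝ) * cfDen b (n + 1) + cfDen b n
        ≤ b n * (A ^ Nat.count M n * cfDen a (n + 1) ^ κ) +
          A ^ Nat.count M (n - 1) * cfDen a n ^ κ := by gcongr
      _ = (b n * A ^ Nat.count M n) * cfDen a (n + 1) ^ κ +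
          A ^ Nat.count M (n - 1) * cfDen a n ^ κ := by ring
      _ ≤ (A ^ Nat.count M (n + 1) * (a n : ℝ) ^ κ) * cfDen a (n + 1) ^ κ +
          A ^ Nat.count M (n + 1) * cfDen a n ^ κ := by gcongr
      _ = A ^ Nat.count M (n + 1) * ((a n * cfDen a (n + 1)) ^ κ + cfDen a n ^ κ) := by
          rw [Real.mul_rpow (by positivity) h1]
          ring
      _ ≤ _ := by
          gcongr
          exact Real.add_rpow_le_rpow_add (by positivity) h2 hκ

theorem count_add_mod_lt_le (ℓ G e n : ℕ) :
    Nat.count (fun k ↦ (k + e) % G < ℓ) n ≤ ((n + e) / G + 1) * ℓ := by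
  rw [Nat.count_eq_card_filter_range]
  calc _ ≤ (Finset.range ((n + e) / G + 1) ×ˢ Finset.range ℓ).card := by
        refine Finset.card_le_card_of_injOn (fun k ↦ ((k + e) / G, (k + e) % G)) ?_ ?_
        · intro k hk
          simp only [Finset.coe_filter, Finset.mem_range, mem_ofPred_eq] at hk
          simp only [Finset.coe_product, Finset.coe_range, mem_prod, mem_Iio]
          exact ⟨Nat.lt_succ_of_le (Nat.div_le_div_right (by omega)), hk.2⟩
        · intro k _ k' _ hkk
          simp only [Prod.mk.injEq] at hkk
          have h1 := Nat.div_add_mod (k + e) G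
          have h2 := Nat.div_add_mod (k' + e) G
          rw [hkk.1, hkk.2] at h1
          omega
    _ = _ := by simp

/-- If the proportion of positions selected by a periodic pattern is small enough, then
exponentials in the number of selected positions are dominated by small powers of `cfDen`. -/
theorem exists_pow_count_le (ℓ : ℕ) {A ε : ℝ} (hA : 1 ≤ A) (hε : 0 < ε) :
    ∃ G : ℕ, 0 < G ∧ ∀ e : ℕ, ∃ B : ℝ, 0 ≤ B ∧ ∀ a : ℕ → ℕ, (∀ k, 1 ≤ a k) → ∀ n,
      A ^ Nat.count (fun k ↦ (k + e) % G < ℓ) n ≤ B * cfDen a (n + 1) ^ ε := by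
  have hlog2 : 0 < Real.log 2 := Real.log_pos (by norm_num)
  have hlogA : 0 ≤ Real.log A := Real.log_nonneg hA
  obtain ⟨G, hG⟩ := exists_nat_gt (ℓ * Real.log A / (ε / 2 * Real.log 2))
  have hG0 : (0 : ℝ) < G := lt_of_le_of_lt (by positivity) hG
  rw [div_lt_iff₀ (by positivity)] at hG
  refine ⟨G, by exact_mod_cast hG0, fun e ↦
    ⟨A ^ ((e + 1) * ℓ) * 2 ^ (ε / 2), by positivity, fun a ha n ↦ ?_⟩⟩
  have hq := one_le_cfDen ha n
  have hcount : Nat.count (fun k ↦ (k + e) % G < ℓ) n ≤ n / G * ℓ + (e + 1) * ℓ := by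
    refine (count_add_mod_lt_le ℓ G e n).trans ?_
    rw [← add_mul]
    refine Nat.mul_le_mul_right _ ?_
    have : (n + e) / G ≤ n / G + e := by
      have hG' : 0 < G := by exact_mod_cast hG0
      calc (n + e) / G ≤ (n + G * e) / G :=
            Nat.div_le_div_right (by nlinarith)
        _ = n / G + e := Nat.add_mul_div_left _ _ hG'
    omega
  have hmain : A ^ (n / G * ℓ) ≤ (2 : ℝ) ^ (ε / 2 * n) := by
    rw [← Real.rpow_natCast, ← Real.exp_log (show 0 < A by linarith), ← Real.exp_mul,
      Real.rpow_def_of_pos two_pos, Real.exp_le_exp]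
    have h1 : ((n / G : ℕ) : ℝ) ≤ n / G := Nat.cast_div_le
    push_cast
    calc Real.log A * (((n / G : ℕ) : ℝ) * ℓ) ≤ Real.log A * (n / G * ℓ) := by gcongr
      _ = n / G * (ℓ * Real.log A) := by ring
      _ ≤ n / G * (G * (ε / 2 * Real.log 2)) := by gcongr
      _ = Real.log 2 * (ε / 2 * n) := by field_simp
  calc A ^ Nat.count (fun k ↦ (k + e) % G < ℓ) n ≤ A ^ (n / G * ℓ + (e + 1) * ℓ) :=
        pow_le_pow_right₀ hA hcount
    _ = A ^ ((e + 1) * ℓ) * A ^ (n / G * ℓ) := by rw [pow_add, mul_comm]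
    _ ≤ A ^ ((e + 1) * ℓ) * (2 : ℝ) ^ (ε / 2 * n) := by gcongr
    _ = A ^ ((e + 1) * ℓ) * ((2 : ℝ) ^ n) ^ (ε / 2) := by
        rw [mul_comm (ε / 2), Real.rpow_mul (by norm_num), Real.rpow_natCast]
    _ ≤ A ^ ((e + 1) * ℓ) * (2 * cfDen a (n + 1) ^ 2) ^ (ε / 2) := by
        gcongr
        exact two_pow_le_cfDen_sq ha n
    _ = _ := by
        have hsq : (cfDen a (n + 1) ^ 2) ^ (ε / 2) = cfDen a (n + 1) ^ ε := by
          rw [← Real.rpow_natCast, ← Real.rpow_mul (by linarith)]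
          congr 1
          push_cast
          ring
        rw [Real.mul_rpow (by norm_num) (by positivity), hsq, mul_assoc]

/-- The increasing digit maps which send digits to primes at the positions selected by a periodic
pattern, and leave the other digits unchanged. -/
noncomputable def primeDigit (ℓ G e k d : ℕ) : ℕ :=
  if (k + e) % G < ℓ then Nat.nth Nat.Prime d else d

theorem strictMono_nth_prime : StrictMono (Nat.nth Nat.Prime) :=
  Nat.nth_strictMono Nat.infinite_setOfPred_prime

theorem strictMono_primeDigit (ℓ G e k : ℕ) : StrictMono (primeDigit ℓ G e k) := by
  intro d d' hd
  unfold primeDigit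
  split_ifs
  · exact strictMono_nth_prime hd
  · exact hd

theorem dimH_le_mul_of_rpow_abs_sub_le {X Y : Set ℝ} {f : ℝ → ℝ} (hf : MapsTo f X Y) {C τ : ℝ}
    (hC : 0 ≤ C) (hτ : 0 < τ) (h : ∀ x ∈ X, ∀ x' ∈ X, |x - x'| ^ τ ≤ C * |f x - f x'|) :
    dimH X ≤ ENNReal.ofReal τ * dimH Y := by
  have hinj : InjOn f X := by
    intro x hx x' hx' hxx
    have := h x hx x' hx'
    rw [hxx, sub_self, abs_zero, mul_zero] at this
    by_contra hne
    exact absurd this (not_le.2 (Real.rpow_pos_of_pos (abs_pos.2 (sub_ne_zero.2 hne)) _))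
  set g := Function.invFunOn f X
  have hg : ∀ x ∈ X, g (f x) = x := fun x hx ↦ hinj.leftInvOn_invFunOn hx
  have hgX : g '' (f '' X) = X := by
    rw [image_image]
    exact (image_congr hg).trans (image_id' X)
  have hτ' : 0 < τ⁻¹ := inv_pos.2 hτ
  have hhol : HolderOnWith (C ^ τ⁻¹).toNNReal τ⁻¹.toNNReal g (f '' X) := by
    rintro _ ⟨x, hx, rfl⟩ _ ⟨x', hx', rfl⟩
    rw [hg x hx, hg x' hx', edist_dist, edist_dist, Real.dist_eq, Real.dist_eq,
      Real.coe_toNNReal _ hτ'.le, ENNReal.ofReal_rpow_of_nonneg (abs_nonneg _) hτ'.le,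
      ENNReal.ofNNReal_toNNReal, ← ENNReal.ofReal_mul (by positivity)]
    refine ENNReal.ofReal_le_ofReal ?_
    rw [← Real.mul_rpow hC (abs_nonneg _), Real.le_rpow_inv_iff_of_pos (abs_nonneg _)
      (by positivity) hτ]
    exact h x hx x' hx'
  have hdim := hhol.dimH_image_le (Real.toNNReal_pos.2 hτ')
  rw [hgX, ENNReal.ofNNReal_toNNReal, ENNReal.ofReal_inv_of_pos hτ, ENNReal.div_eq_inv_mul,
    inv_inv] at hdim
  calc dimH X ≤ ENNReal.ofReal τ * dimH (f '' X) := hdim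
    _ ≤ ENNReal.ofReal τ * dimH Y := by
        gcongr
        exact hf.image_subset

/-- Points of `Eℓ ℓ φ` whose large products occur infinitely often in a given residue class. -/
def EℓMod (ℓ : ℕ) (φ : ℕ → ℝ) (G e : ℕ) : Set ℝ :=
  {x | x ∈ Set.Ico (0 : ℝ) 1 ∧ Irrational x ∧ {n : ℕ | (1 ≤ n ∧
    φ n ≤ ∏ i ∈ Finset.range ℓ, (cfA x (n + i) : ℝ)) ∧ n % G = e}.Infinite}

theorem Eℓ_subset_iUnion (ℓ : ℕ) (φ : ℕ → ℝ) {G : ℕ} (hG : 0 < G) :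
    Eℓ ℓ φ ⊆ ⋃ e : Fin G, EℓMod ℓ φ G e := by
  rintro x ⟨hx, hirr, hinf⟩
  by_contra hnot
  simp only [mem_iUnion, EℓMod, mem_ofPred_eq, hx, hirr, true_and, not_exists, not_infinite]
    at hnot
  refine hinf ((finite_iUnion hnot).subset fun n hn ↦ ?_)
  exact mem_iUnion.2 ⟨⟨n % G, Nat.mod_lt _ hG⟩, hn, rfl⟩

theorem dimH_EℓMod_le (ℓ : ℕ) (φ : ℕ → ℝ) {ε A B : ℝ} (hε : 0 < ε) (hA : 1 ≤ A) (hB : 0 ≤ B)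
    (hprime : ∀ n : ℕ, 1 ≤ n → (Nat.nth Nat.Prime n : ℝ) ≤ A * (n : ℝ) ^ (1 + ε)) {G e : ℕ}
    (he : e < G) (hcount : ∀ a : ℕ → ℕ, (∀ k, 1 ≤ a k) → ∀ n,
      A ^ Nat.count (fun k ↦ (k + (G + 1 - e)) % G < ℓ) n ≤ B * cfDen a (n + 1) ^ ε) :
    dimH (EℓMod ℓ φ G e) ≤ ENNReal.ofReal (1 + 4 * ε) * dimH (Eprimeℓ ℓ φ) := by
  set m := primeDigit ℓ G (G + 1 - e) with hmdef
  have hm : ∀ k, StrictMono (m k) := strictMono_primeDigit ℓ G (G + 1 - e)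
  have hpow : ∀ d : ℕ, 1 ≤ d → (d : ℝ) ≤ (d : ℝ) ^ (1 + ε) := fun d hd ↦
    Real.self_le_rpow_of_one_le (by exact_mod_cast hd) (by linarith)
  have hex : ∀ x ∈ EℓMod ℓ φ G e, ∃ v, IsCF (fun k ↦ m k (cfA x (k + 1))) v := fun x hx ↦
    exists_isCF fun k ↦
      ((isCF_of_irrational hx.1 hx.2.1).one_le k).trans ((hm k).le_apply)
  choose! v hv using hex
  have hpair : ∀ x ∈ EℓMod ℓ φ G e, IsCFPair m A (1 + 2 * ε) (fun k ↦ cfA x (k + 1))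
      (fun k ↦ gaussMap^[k] x) (v x) := by
    intro x hx
    have hcf := isCF_of_irrational hx.1 hx.2.1
    refine ⟨hcf, hv x hx, fun k ↦ ?_⟩
    have h1 : (1 : ℝ) ≤ cfA x (k + 1) := by exact_mod_cast hcf.one_le k
    have h2 : ((cfA x (k + 1) : ℕ) : ℝ) ^ (1 + ε) ≤ (cfA x (k + 1) : ℝ) ^ (1 + 2 * ε) :=
      Real.rpow_le_rpow_of_exponent_le h1 (by linarith)
    have h3 := hpow _ (hcf.one_le k)
    have h4 : 0 ≤ ((cfA x (k + 1) : ℕ) : ℝ) ^ (1 + 2 * ε) := by positivity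
    simp only [hmdef, primeDigit]
    split_ifs
    · refine (hprime _ (hcf.one_le k)).trans ?_
      gcongr
    · nlinarith
  have hq : ∀ x ∈ EℓMod ℓ φ G e, ∀ n, cfDen (fun k ↦ m k (cfA x (k + 1))) (n + 1) ≤
      B * cfDen (fun k ↦ cfA x (k + 1)) (n + 1) ^ (1 + 2 * ε) := by
    intro x hx n
    have hcf := isCF_of_irrational hx.1 hx.2.1
    have h1 := one_le_cfDen hcf.one_le n
    have h2 := cfDen_le_pow_count_mul (a := fun k ↦ cfA x (k + 1))
      (b := fun k ↦ m k (cfA x (k + 1))) (M := fun k ↦ (k + (G + 1 - e)) % G < ℓ) hA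
      (κ := 1 + ε) (by linarith)
      (fun k hk ↦ by
        simp only [hmdef, primeDigit, hk, if_true]
        exact hprime _ (hcf.one_le k))
      (fun k hk ↦ by
        simp only [hmdef, primeDigit, hk, if_false]
        exact hpow _ (hcf.one_le k)) (n + 1)
    rw [Nat.add_sub_cancel] at h2
    refine h2.trans ?_
    rw [show 1 + 2 * ε = ε + (1 + ε) by ring, Real.rpow_add (by linarith) ε, ← mul_assoc]
    exact mul_le_mul_of_nonneg_right (hcount _ hcf.one_le n) (by positivity)
  refine dimH_le_mul_of_rpow_abs_sub_le (f := fun x ↦ v x 0)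
    (C := 16 * 2 ^ (1 + 2 * ε) * A ^ 3 * (2 * B) ^ 2) ?_ (by positivity) (by linarith) ?_
  · intro x hx
    have hvx := hv x hx
    refine ⟨⟨(hvx.pos 0).le, hvx.lt_one 0⟩, hvx.irrational 0, hx.2.2.mono ?_⟩
    rintro n ⟨⟨hn, hφn⟩, hne⟩
    refine ⟨hn, hφn.trans ?_⟩
    refine Finset.prod_le_prod (fun _ _ ↦ by positivity) fun i hi ↦ ?_
    have hi' := Finset.mem_range.1 hi
    have hidx : n + i = n - 1 + i + 1 := by omega
    have hmod : (n - 1 + i + (G + 1 - e)) % G < ℓ := by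
      have h1 : n - 1 + i + (G + 1 - e) = i + G * (n / G + 1) := by
        have := Nat.div_add_mod n G
        rw [hne] at this
        rw [mul_add, mul_one]
        omega
      rw [h1, Nat.add_mul_mod_self_left]
      exact (Nat.mod_le _ _).trans_lt hi'
    have hval : cfA (v x 0) (n + i) = Nat.nth Nat.Prime (cfA x (n + i)) := by
      rw [hidx, hvx.cfA_eq]
      simp only [hmdef, primeDigit, hmod, if_true]
    rw [cfA', hval, if_pos (Nat.prime_nth_prime _)]
    exact_mod_cast strictMono_nth_prime.le_apply
  · intro x hx x' hx'
    have := (hpair x hx).rpow_abs_sub_le (hpair x' hx') hm (by linarith) hA hB (hq x hx)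
      (hq x' hx')
    rwa [show 2 * (1 + 2 * ε) - 1 = 1 + 4 * ε by ring] at this

theorem dimH_Eℓ_le_mul (ℓ : ℕ) (φ : ℕ → ℝ) {ε : ℝ} (hε : 0 < ε) :
    dimH (Eℓ ℓ φ) ≤ ENNReal.ofReal (1 + 4 * ε) * dimH (Eprimeℓ ℓ φ) := by
  obtain ⟨A, hA, hprime⟩ := nth_prime_le_rpow hε
  obtain ⟨G, hG, hcount⟩ := exists_pow_count_le ℓ hA hε
  refine (dimH_mono (Eℓ_subset_iUnion ℓ φ hG)).trans ?_
  rw [dimH_iUnion]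
  refine iSup_le fun e ↦ ?_
  obtain ⟨B, hB, hcB⟩ := hcount (G + 1 - e)
  exact dimH_EℓMod_le ℓ φ hε hA hB hprime e.2 hcB

theorem Eprimeℓ_subset_Eℓ (ℓ : ℕ) (φ : ℕ → ℝ) : Eprimeℓ ℓ φ ⊆ Eℓ ℓ φ := by
  rintro x ⟨hx, hirr, hinf⟩
  refine ⟨hx, hirr, hinf.mono ?_⟩
  rintro n ⟨hn, hφn⟩
  refine ⟨hn, hφn.trans (Finset.prod_le_prod (fun _ _ ↦ by positivity) fun i _ ↦ ?_)⟩
  rw [cfA']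
  split_ifs
  · exact le_rfl
  · simp

/-- **Theorem.** For every positive integer `ℓ` and every function `φ : ℕ → (0, ∞)`,
the Hausdorff dimension of `E′_ℓ(φ)` equals that of `E_ℓ(φ)`. -/
theorem dimH_Eprimeℓ_eq_dimH_Eℓ (ℓ : ℕ) (hℓ : 1 ≤ ℓ) (φ : ℕ → ℝ) (hφ : ∀ n, 0 < φ n) :
    dimH (Eprimeℓ ℓ φ) = dimH (Eℓ ℓ φ) := by
  refine le_antisymm (dimH_mono (Eprimeℓ_subset_Eℓ ℓ φ)) ?_
  have hlim : Tendsto (fun n : ℕ ↦ ENNReal.ofReal (1 + 4 * (1 / ((n : ℝ) + 1))) *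
      dimH (Eprimeℓ ℓ φ)) atTop (nhds (ENNReal.ofReal (1 + 4 * 0) * dimH (Eprimeℓ ℓ φ))) := by
    refine ENNReal.Tendsto.mul_const (ENNReal.tendsto_ofReal ?_) (Or.inl (by simp))
    exact (tendsto_one_div_add_atTop_nhds_zero_nat.const_mul 4).const_add 1
  have := ge_of_tendsto' hlim fun n ↦ dimH_Eℓ_le_mul ℓ φ (ε := 1 / ((n : ℝ) + 1)) (by positivity)
  simpa using this
end
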